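/- arXiv:0709.0626 — 6 statements merged into one kernel-verified Lean document; each statement's English description precedes it below -/
import Mathlib

section
/- Let L be an invariant loss function of lower order p > 0, let f: X → ℝ be measurable, and let P be a probability distribution on X × Y with finite L-risk R_{L,P}(f) < ∞. Then |P|_p = ∫ |y|^p dP(x,y) < ∞ if and only if f ∈ L_p(P_X). -/
open MeasureTheory Filter Set Topology

/-- A real function has finite `p`-th absolute moment if and only if it lies in `L^p`. -/
theorem integrable_abs_rpow_iff_memLp {Ω : Type*} [MeasurableSpace Ω] {μ : Measure Ω}
    {p : ℝ} (hp : 0 < p) {g : Ω → ℝ} (hg : AEStronglyMeasurable g μ) :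
    Integrable (fun ω => |g ω| ^ p) μ ↔ MemLp g (ENNReal.ofReal p) μ := by
  have h := integrable_norm_rpow_iff hg (p := ENNReal.ofReal p) (by simpa using hp)
    ENNReal.ofReal_ne_top
  simpa only [ENNReal.toReal_ofReal hp.le, Real.norm_eq_abs] using h

/-- If one of two functions differing by an `L^p` function lies in `L^p`, so does the other. -/
theorem memLp_iff_of_memLp_sub {Ω E : Type*} [MeasurableSpace Ω] [NormedAddCommGroup E]
    {μ : Measure Ω} {p : ENNReal} {g h : Ω → E} (hgh : MemLp (g - h) p μ) :
    MemLp g p μ ↔ MemLp h p μ :=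
  ⟨fun hg => by simpa using hg.sub hgh, fun hh => by simpa using hgh.add hh⟩

/-- Finite risk for a loss of lower order `p` bounds the `p`-th moment of the residual. -/
theorem integrable_abs_rpow_of_lower_order {Ω : Type*} [MeasurableSpace Ω] {μ : Measure Ω}
    [IsFiniteMeasure μ] {p c : ℝ} (hc : 0 < c) {r k : Ω → ℝ} (hr : Measurable r)
    (hk : Integrable k μ) (hrk : ∀ᵐ ω ∂μ, c * (|r ω| ^ p - 1) ≤ k ω) :
    Integrable (fun ω => |r ω| ^ p) μ := by
  refine ((hk.const_mul c⁻¹).add (integrable_const (1 : ℝ))).mono'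
    (hr.abs.pow_const p).aestronglyMeasurable ?_
  filter_upwards [hrk] with ω hω
  rw [Real.norm_of_nonneg (by positivity)]
  have := (le_inv_mul_iff₀ hc).2 hω
  simp only [Pi.add_apply]
  linarith

/-- Lemma 7: if `L` is an invariant loss of lower order `p > 0`, `f` is measurable and
the `L`-risk of `f` is finite, then `|P|_p < ∞` if and only if `f ∈ L_p(P_X)`. -/
theorem moment_finite_iff_memLp_of_finite_risk
    {X : Type*} [MeasurableSpace X]
    (Y : Set ℝ) (hYne : Y.Nonempty) (hYclosed : IsClosed Y)
    (L : ℝ → ℝ → ℝ)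
    (hLmeas : Measurable fun q : ℝ × ℝ => L q.1 q.2)
    (l : ℝ → ℝ) (hl0 : l 0 = 0) (hlnonneg : ∀ r : ℝ, 0 ≤ l r)
    (hinv : ∀ y ∈ Y, ∀ t : ℝ, L y t = l (y - t))
    (p : ℝ) (hp : 0 < p)
    (hlower : ∃ c > (0 : ℝ), ∀ r : ℝ, c * (|r| ^ p - 1) ≤ l r)
    (P : Measure (X × ℝ)) [IsProbabilityMeasure P]
    (hPsupp : ∀ᵐ z ∂P, z.2 ∈ Y)
    (f : X → ℝ) (hf : Measurable f)
    (hrisk : Integrable (fun z : X × ℝ => L z.2 (f z.1)) P) :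
    Integrable (fun z : X × ℝ => |z.2| ^ p) P ↔
      Integrable (fun x : X => |f x| ^ p) (P.map Prod.fst) := by
  obtain ⟨c, hc, hlow⟩ := hlower
  have hfst : Measurable fun z : X × ℝ => f z.1 := hf.comp measurable_fst
  have hres_meas : Measurable (Prod.snd - fun z : X × ℝ => f z.1) := measurable_snd.sub hfst
  have hres : MemLp (Prod.snd - fun z : X × ℝ => f z.1) (ENNReal.ofReal p) P := by
    rw [← integrable_abs_rpow_iff_memLp hp hres_meas.aestronglyMeasurable]
    refine integrable_abs_rpow_of_lower_order hc hres_meas hrisk ?_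
    filter_upwards [hPsupp] with z hz
    rw [hinv z.2 hz]
    exact hlow _
  rw [integrable_abs_rpow_iff_memLp hp measurable_snd.aestronglyMeasurable,
    integrable_abs_rpow_iff_memLp hp hf.aestronglyMeasurable,
    memLp_map_measure_iff hf.aestronglyMeasurable measurable_fst.aemeasurable]
  exact memLp_iff_of_memLp_sub hres
end

section
/- Let L be a convex loss function of type (a, p), let P be a probability distribution on X × Y with |P|_a < ∞, let H be the RKHS of a bounded measurable kernel k, and let λ > 0. Then there exists a unique minimizer f_{P,λ} ∈ H of the regularized risk f ↦ E_P L(Y, f(X)) + λ‖f‖_H², and it satisfies ‖f_{P,λ}‖_H ≤ √(R_{L,P}(0)/λ), where R_{L,P}(0) = E_P L(Y, 0). -/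
open MeasureTheory Filter Set Topology
open scoped RealInnerProductSpace

/-- Midpoint strong convexity of a convex function plus a multiple of the squared norm. -/
theorem ConvexOn.midpoint_add_mul_sq_norm_le
    {H : Type*} [NormedAddCommGroup H] [InnerProductSpace ℝ H]
    {R : H → ℝ} (hR : ConvexOn ℝ univ R) (lam : ℝ) (f g : H) :
    R ((1 / 2 : ℝ) • f + (1 / 2 : ℝ) • g)
        + lam * ‖(1 / 2 : ℝ) • f + (1 / 2 : ℝ) • g‖ ^ 2 + lam / 4 * ‖f - g‖ ^ 2 ≤
      ((R f + lam * ‖f‖ ^ 2) + (R g + lam * ‖g‖ ^ 2)) / 2 := by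
  have h1 := hR.2 (mem_univ f) (mem_univ g) (by norm_num : (0 : ℝ) ≤ 1 / 2)
    (by norm_num : (0 : ℝ) ≤ 1 / 2) (by norm_num)
  have h2 : ‖(1 / 2 : ℝ) • f + (1 / 2 : ℝ) • g‖ ^ 2 = ‖f + g‖ ^ 2 / 4 := by
    rw [← smul_add, norm_smul, mul_pow, Real.norm_eq_abs, sq_abs]
    ring
  have h3 := parallelogram_law_with_norm ℝ f g
  have h4 : lam * ‖f + g‖ ^ 2 + lam * ‖f - g‖ ^ 2 =
      2 * (lam * ‖f‖ ^ 2 + lam * ‖g‖ ^ 2) := by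
    linear_combination lam * h3
  rw [h2]
  simp only [smul_eq_mul] at h1
  linarith

/-- A minimizer of a convex function plus a positive multiple of the squared norm is unique. -/
theorem ConvexOn.eq_of_forall_add_mul_sq_norm_le
    {H : Type*} [NormedAddCommGroup H] [InnerProductSpace ℝ H]
    {R : H → ℝ} (hR : ConvexOn ℝ univ R) {lam : ℝ} (hlam : 0 < lam) {f g : H}
    (hf : ∀ h, R f + lam * ‖f‖ ^ 2 ≤ R h + lam * ‖h‖ ^ 2)
    (hg : ∀ h, R g + lam * ‖g‖ ^ 2 ≤ R h + lam * ‖h‖ ^ 2) : g = f := by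
  have h1 := hR.midpoint_add_mul_sq_norm_le lam g f
  have h2 := hf ((1 / 2 : ℝ) • g + (1 / 2 : ℝ) • f)
  have h3 := hg ((1 / 2 : ℝ) • g + (1 / 2 : ℝ) • f)
  have h4 : lam / 4 * ‖g - f‖ ^ 2 ≤ 0 := by linarith
  have h5 : ‖g - f‖ ^ 2 ≤ 0 := by
    by_contra! h
    have : 0 < lam / 4 * ‖g - f‖ ^ 2 := by positivity
    linarith
  exact sub_eq_zero.1 (norm_eq_zero.1 (pow_eq_zero_iff two_ne_zero |>.1
    (le_antisymm h5 (sq_nonneg _))))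

/-- On a Hilbert space, a continuous nonnegative convex function plus a positive multiple of the
squared norm attains its minimum. -/
theorem ConvexOn.exists_forall_add_mul_sq_norm_le
    {H : Type*} [NormedAddCommGroup H] [InnerProductSpace ℝ H] [CompleteSpace H]
    {R : H → ℝ} (hR : ConvexOn ℝ univ R) (hcont : Continuous R) (hnonneg : ∀ f, 0 ≤ R f)
    {lam : ℝ} (hlam : 0 < lam) :
    ∃ f, ∀ h, R f + lam * ‖f‖ ^ 2 ≤ R h + lam * ‖h‖ ^ 2 := by
  set F : H → ℝ := fun f => R f + lam * ‖f‖ ^ 2 with hF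
  have hbdd : BddBelow (range F) := by
    refine ⟨0, ?_⟩
    rintro _ ⟨f, rfl⟩
    have := hnonneg f
    positivity
  have hinf : ∀ f, iInf F ≤ F f := ciInf_le hbdd
  have hex : ∀ n : ℕ, ∃ f, F f < iInf F + 1 / ((n : ℝ) + 1) := fun n =>
    exists_lt_of_ciInf_lt (lt_add_of_pos_right _ Nat.one_div_pos_of_nat)
  choose u hu using hex
  have hcauchy : CauchySeq u := by
    refine cauchySeq_of_le_tendsto_0 (fun N : ℕ => √(4 / lam * (1 / ((N : ℝ) + 1)))) ?_ ?_
    · intro n m N hn hm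
      rw [dist_eq_norm]
      apply Real.le_sqrt_of_sq_le
      have h1 := hR.midpoint_add_mul_sq_norm_le lam (u n) (u m)
      have h2 := hinf ((1 / 2 : ℝ) • u n + (1 / 2 : ℝ) • u m)
      have h3 := hu n
      have h4 := hu m
      have h5 : 1 / ((n : ℝ) + 1) ≤ 1 / ((N : ℝ) + 1) := Nat.one_div_le_one_div hn
      have h6 : 1 / ((m : ℝ) + 1) ≤ 1 / ((N : ℝ) + 1) := Nat.one_div_le_one_div hm
      simp only [hF] at h2 h3 h4
      have h7 : lam / 4 * ‖u n - u m‖ ^ 2 ≤ 1 / ((N : ℝ) + 1) := by linarith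
      calc ‖u n - u m‖ ^ 2 = 4 / lam * (lam / 4 * ‖u n - u m‖ ^ 2) := by field_simp
        _ ≤ 4 / lam * (1 / ((N : ℝ) + 1)) := by gcongr
    · have h := (tendsto_one_div_add_atTop_nhds_zero_nat (𝕜 := ℝ)).const_mul (4 / lam)
      simpa using h.sqrt
  obtain ⟨f, hf⟩ := cauchySeq_tendsto_of_complete hcauchy
  refine ⟨f, fun h => le_trans ?_ (hinf h)⟩
  have hFc : Continuous F := by fun_prop
  have hlim : Tendsto (fun n : ℕ => iInf F + 1 / ((n : ℝ) + 1)) atTop (𝓝 (iInf F)) := by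
    simpa using (tendsto_one_div_add_atTop_nhds_zero_nat (𝕜 := ℝ)).const_add (iInf F)
  exact le_of_tendsto_of_tendsto' ((hFc.tendsto f).comp hf) hlim fun n => (hu n).le

/-- Proposition 8: for a convex loss of type `(a,p)`, a distribution `P` with
`|P|_a < ∞`, the RKHS `H` of a bounded measurable kernel (represented by a separable
real Hilbert space `H` with bounded measurable feature map `Φ`, elements acting via
`f(x) = ⟪f, Φ x⟫`) and `λ > 0`, there is a unique minimizer `f_{P,λ}` of the
regularized risk `f ↦ E_P L(Y, f(X)) + λ ‖f‖²`, and it satisfies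
`‖f_{P,λ}‖ ≤ √(R_{L,P}(0) / λ)`. -/
theorem exists_unique_regularized_risk_minimizer
    {X : Type*} [MeasurableSpace X]
    {H : Type*} [NormedAddCommGroup H] [InnerProductSpace ℝ H] [CompleteSpace H]
    [SecondCountableTopology H]
    (Y : Set ℝ) (hYne : Y.Nonempty) (hYclosed : IsClosed Y)
    (L : ℝ → ℝ → ℝ)
    (hLmeas : Measurable fun q : ℝ × ℝ => L q.1 q.2)
    (hLnonneg : ∀ y ∈ Y, ∀ t : ℝ, 0 ≤ L y t)
    (hLconv : ∀ y ∈ Y, ConvexOn ℝ Set.univ (L y))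
    (a : ℝ → ℝ) (hameas : Measurable a) (hanonneg : ∀ y ∈ Y, 0 ≤ a y)
    (p : ℝ) (hp : 0 ≤ p)
    (htype : ∃ c > (0 : ℝ), ∀ y ∈ Y, ∀ t : ℝ, L y t ≤ c * (a y + |t| ^ p + 1))
    (P : Measure (X × ℝ)) [IsProbabilityMeasure P]
    (hPsupp : ∀ᵐ z ∂P, z.2 ∈ Y)
    (hPa : Integrable (fun z : X × ℝ => a z.2) P)
    (Φ : X → H) (hΦmeas : StronglyMeasurable Φ)
    (kb : ℝ) (hkb : ∀ x : X, ‖Φ x‖ ≤ kb)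
    (lam : ℝ) (hlam : 0 < lam) :
    ∃ f₀ : H,
      (∀ f : H,
        (∫ z, L z.2 ⟪f₀, Φ z.1⟫ ∂P) + lam * ‖f₀‖ ^ 2 ≤
          (∫ z, L z.2 ⟪f, Φ z.1⟫ ∂P) + lam * ‖f‖ ^ 2) ∧
      (∀ g : H,
        (∀ f : H,
          (∫ z, L z.2 ⟪g, Φ z.1⟫ ∂P) + lam * ‖g‖ ^ 2 ≤
            (∫ z, L z.2 ⟪f, Φ z.1⟫ ∂P) + lam * ‖f‖ ^ 2) → g = f₀) ∧
      ‖f₀‖ ≤ Real.sqrt ((∫ z, L z.2 0 ∂P) / lam) := by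
  obtain ⟨c, hc, htype⟩ := htype
  have hmeas : ∀ f : H, AEStronglyMeasurable (fun z : X × ℝ => L z.2 ⟪f, Φ z.1⟫) P := by
    intro f
    have h1 : Measurable fun z : X × ℝ => ⟪f, Φ z.1⟫ :=
      ((stronglyMeasurable_const (b := f)).inner
        (hΦmeas.comp_measurable measurable_fst)).measurable
    exact (hLmeas.comp (measurable_snd.prodMk h1)).aestronglyMeasurable
  have hbound : ∀ (M : ℝ) (f : H), ‖f‖ ≤ M → ∀ᵐ z ∂P,
      ‖L z.2 ⟪f, Φ z.1⟫‖ ≤ c * (a z.2 + (M * kb) ^ p + 1) := by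
    intro M f hf
    filter_upwards [hPsupp] with z hz
    rw [Real.norm_of_nonneg (hLnonneg _ hz _)]
    refine (htype _ hz _).trans ?_
    have h1 : |⟪f, Φ z.1⟫| ≤ M * kb :=
      (abs_real_inner_le_norm _ _).trans
        (mul_le_mul hf (hkb _) (norm_nonneg _) ((norm_nonneg _).trans hf))
    gcongr
  have hbint : ∀ M : ℝ, Integrable (fun z : X × ℝ => c * (a z.2 + (M * kb) ^ p + 1)) P :=
    fun M => ((hPa.add (integrable_const _)).add (integrable_const _)).const_mul c
  have hint : ∀ f : H, Integrable (fun z : X × ℝ => L z.2 ⟪f, Φ z.1⟫) P := fun f =>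
    (hbint ‖f‖).mono' (hmeas f) (hbound _ f le_rfl)
  have hconv : ConvexOn ℝ univ fun f : H => ∫ z, L z.2 ⟪f, Φ z.1⟫ ∂P := by
    refine ⟨convex_univ, fun f _ g _ s t hs ht hst => ?_⟩
    simp only [smul_eq_mul]
    rw [← integral_const_mul, ← integral_const_mul,
      ← integral_add ((hint f).const_mul s) ((hint g).const_mul t)]
    refine integral_mono_ae (hint _) (((hint f).const_mul s).add ((hint g).const_mul t)) ?_
    filter_upwards [hPsupp] with z hz
    have := (hLconv _ hz).2 (mem_univ ⟪f, Φ z.1⟫) (mem_univ ⟪g, Φ z.1⟫) hs ht hst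
    simpa [inner_add_left, real_inner_smul_left] using this
  have hcont : Continuous fun f : H => ∫ z, L z.2 ⟪f, Φ z.1⟫ ∂P := by
    refine continuous_iff_continuousAt.2 fun f => ?_
    refine continuousAt_of_dominated (Eventually.of_forall hmeas) ?_ (hbint (‖f‖ + 1)) ?_
    · have : ∀ᶠ g : H in 𝓝 f, ‖g‖ < ‖f‖ + 1 :=
        continuous_norm.continuousAt.eventually_lt continuousAt_const (lt_add_one _)
      exact this.mono fun g hg => hbound _ g hg.le
    · filter_upwards [hPsupp] with z hz
      have hLc : Continuous (L z.2) :=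
        continuousOn_univ.1 ((hLconv _ hz).continuousOn isOpen_univ)
      exact (hLc.comp (by fun_prop : Continuous fun g : H => ⟪g, Φ z.1⟫)).continuousAt
  have hnonneg : ∀ f : H, 0 ≤ ∫ z, L z.2 ⟪f, Φ z.1⟫ ∂P := fun f =>
    integral_nonneg_of_ae (hPsupp.mono fun z hz => hLnonneg _ hz _)
  obtain ⟨f₀, hf₀⟩ := hconv.exists_forall_add_mul_sq_norm_le hcont hnonneg hlam
  refine ⟨f₀, hf₀, fun g hg => hconv.eq_of_forall_add_mul_sq_norm_le hlam hf₀ hg, ?_⟩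
  apply Real.le_sqrt_of_sq_le
  rw [le_div_iff₀ hlam]
  have h0 := hf₀ 0
  simp only [inner_zero_left, norm_zero] at h0
  have := hnonneg f₀
  linarith
end

section
/- Let X ⊂ ℝ^d be compact, let L be an invariant convex loss function of lower and upper order p ≥ 1, and let H be the RKHS of a universal kernel on X (i.e., a continuous bounded kernel whose RKHS is dense in (C(X), ‖·‖_∞)). Define p* := max{2p, p²} and fix a sequence (λ_n) ⊂ (0,∞) with λ_n → 0 and λ_n^{p*}·n → ∞. Then for every probability distribution P on X × Y with |P|_p < ∞ the kernel-based regression estimator is L-risk consistent: for every ε > 0, the probability P^n of sample sets D = ((x_1,y_1),…,(x_n,y_n)) of n i.i.d. observations from P such that R_{L,P}(f_{D,λ_n}) ≤ R*_{L,P} + ε converges to 1 as n → ∞, where f_{D,λ_n} is the unique minimizer in H of f ↦ (1/n)∑_{i=1}^n L(y_i, f(x_i)) + λ_n‖f‖_H² and R*_{L,P} := inf{R_{L,P}(f) : f: X → ℝ measurable}. -/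
open MeasureTheory Filter Set Topology
open scoped RealInnerProductSpace ENNReal BigOperators

/-- A nonnegative convex function of growth order `p` is locally Lipschitz, with constants
growing of order `p - 1`. -/
lemma exists_abs_sub_le_of_convex_of_growth {l : ℝ → ℝ} (hlnonneg : ∀ r, 0 ≤ l r)
    (hconv : ConvexOn ℝ univ l) {p : ℝ} (hp : 1 ≤ p)
    (hupper : ∃ c > (0 : ℝ), ∀ r : ℝ, l r ≤ c * (|r| ^ p + 1)) :
    ∃ C > (0 : ℝ), ∀ a b : ℝ, |l a - l b| ≤ C * (1 + |a| + |b|) ^ (p - 1) * |a - b| := by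
  obtain ⟨c, hc, hl⟩ := hupper
  have hbound : ∀ T r : ℝ, 1 ≤ T → |r| ≤ 2 * T → l r / T ≤ c * (2 ^ p + 1) * T ^ (p - 1) := by
    intro T r hT hr
    have hT0 : 0 < T := by linarith
    have h1 : |r| ^ p ≤ 2 ^ p * T ^ p := by
      rw [← Real.mul_rpow (by norm_num) hT0.le]
      exact Real.rpow_le_rpow (abs_nonneg _) hr (by linarith)
    have h2 : (1 : ℝ) ≤ T ^ p := Real.one_le_rpow hT (by linarith)
    rw [div_le_iff₀ hT0]
    have h3 : T ^ (p - 1) * T = T ^ p := by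
      rw [← Real.rpow_add_one hT0.ne']; simp
    calc l r ≤ c * (|r| ^ p + 1) := hl r
      _ ≤ c * (2 ^ p * T ^ p + T ^ p) := by gcongr
      _ = c * (2 ^ p + 1) * T ^ (p - 1) * T := by rw [mul_assoc _ _ T, h3]; ring
  have hlt : ∀ a b : ℝ, a < b →
      |l a - l b| ≤ c * (2 ^ p + 1) * (1 + |a| + |b|) ^ (p - 1) * |a - b| := by
    intro a b hab
    set T := 1 + |a| + |b|
    have hT : 1 ≤ T := by have := abs_nonneg a; have := abs_nonneg b; linarith
    have hT0 : 0 < T := by linarith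
    have hba : 0 < b - a := by linarith
    have hr := hconv.slope_mono_adjacent (mem_univ a) (mem_univ (b + T)) hab (by linarith)
    have hleft := hconv.slope_mono_adjacent (mem_univ (a - T)) (mem_univ b) (by linarith) hab
    have e1 : b + T - b = T := by ring
    have e2 : a - (a - T) = T := by ring
    rw [e1] at hr
    rw [e2] at hleft
    have k1 : (l (b + T) - l b) / T ≤ l (b + T) / T := by
      gcongr; linarith [hlnonneg b]
    have k2 : -(l (a - T) / T) ≤ (l a - l (a - T)) / T := by
      rw [← neg_div]; gcongr; linarith [hlnonneg a]
    have m1 := hbound T (b + T) hT (by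
      have h1 := abs_add_le b T
      have := abs_nonneg a
      rw [abs_of_pos hT0] at h1; linarith)
    have m2 := hbound T (a - T) hT (by
      have h1 := abs_sub a T
      have := abs_nonneg b
      rw [abs_of_pos hT0] at h1; linarith)
    have u1 := (div_le_iff₀ hba).1 (hr.trans (k1.trans m1))
    have u2 := (le_div_iff₀ hba).1 ((neg_le_neg m2).trans (k2.trans hleft))
    rw [abs_sub_comm a b, abs_of_pos hba, abs_le]
    constructor <;> linarith
  refine ⟨c * (2 ^ p + 1), by positivity, fun a b => ?_⟩
  rcases lt_trichotomy a b with h | h | h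
  · exact hlt a b h
  · simp [h]
  · have := hlt b a h
    rw [abs_sub_comm, abs_sub_comm a b, add_right_comm]
    exact this

lemma abs_sub_le_of_growth_lipschitz {l : ℝ → ℝ} {p C : ℝ} (hp : 1 ≤ p) (hC : 0 < C)
    (hLip : ∀ a b : ℝ, |l a - l b| ≤ C * (1 + |a| + |b|) ^ (p - 1) * |a - b|)
    {a b R δ : ℝ} (hR : 1 + |a| + |b| ≤ R) (hδ : |a - b| ≤ δ) :
    |l a - l b| ≤ C * R ^ (p - 1) * δ := by
  have h1 : 0 ≤ 1 + |a| + |b| := by positivity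
  have h2 : 0 ≤ R := h1.trans hR
  refine (hLip a b).trans (mul_le_mul ?_ hδ (abs_nonneg _) (by positivity))
  exact mul_le_mul_of_nonneg_left (Real.rpow_le_rpow h1 hR (by linarith)) hC.le

section Minimizers

variable {H : Type*} [NormedAddCommGroup H] [InnerProductSpace ℝ H]

/-- Quadratic growth of a `2`-norm regularized convex functional, at midpoints. -/
lemma regularized_midpoint_le {ψ : H → ℝ} (hψ : ConvexOn ℝ univ ψ) (lam : ℝ) (f g : H) :
    ψ ((1 / 2 : ℝ) • f + (1 / 2 : ℝ) • g) + lam * ‖(1 / 2 : ℝ) • f + (1 / 2 : ℝ) • g‖ ^ 2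
      + lam / 4 * ‖f - g‖ ^ 2 ≤
      ((ψ f + lam * ‖f‖ ^ 2) + (ψ g + lam * ‖g‖ ^ 2)) / 2 := by
  have h := hψ.2 (mem_univ f) (mem_univ g) (by norm_num : (0 : ℝ) ≤ 1 / 2)
    (by norm_num : (0 : ℝ) ≤ 1 / 2) (by norm_num)
  have hpar := parallelogram_law_with_norm ℝ f g
  have hn : ‖(1 / 2 : ℝ) • f + (1 / 2 : ℝ) • g‖ = (1 / 2) * ‖f + g‖ := by
    rw [← smul_add, norm_smul]; norm_num
  rw [hn]
  simp only [smul_eq_mul] at h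
  linear_combination h + lam / 4 * hpar

lemma midpoint_mem_closedBall {B : ℝ} {f g : H} (hf : ‖f‖ ≤ B) (hg : ‖g‖ ≤ B) :
    ‖(1 / 2 : ℝ) • f + (1 / 2 : ℝ) • g‖ ≤ B := by
  refine (norm_add_le _ _).trans ?_
  rw [norm_smul, norm_smul]
  norm_num
  linarith

/-- `f` minimizes the regularized functional `ψ + lam * ‖·‖ ^ 2` on the ball of radius `B`. -/
def IsBallMinimizer (ψ : H → ℝ) (lam B : ℝ) (f : H) : Prop :=
  ‖f‖ ≤ B ∧ ∀ g : H, ‖g‖ ≤ B → ψ f + lam * ‖f‖ ^ 2 ≤ ψ g + lam * ‖g‖ ^ 2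

lemma IsBallMinimizer.gap {ψ : H → ℝ} (hψ : ConvexOn ℝ univ ψ) {lam B : ℝ} {f g : H}
    (hf : IsBallMinimizer ψ lam B f) (hg : ‖g‖ ≤ B) :
    lam / 2 * ‖f - g‖ ^ 2 ≤ (ψ g + lam * ‖g‖ ^ 2) - (ψ f + lam * ‖f‖ ^ 2) := by
  have h1 := regularized_midpoint_le hψ lam f g
  have h2 := hf.2 _ (midpoint_mem_closedBall hf.1 hg)
  linarith

lemma IsBallMinimizer.unique {ψ : H → ℝ} (hψ : ConvexOn ℝ univ ψ) {lam B : ℝ} (hlam : 0 < lam)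
    {f g : H} (hf : IsBallMinimizer ψ lam B f) (hg : IsBallMinimizer ψ lam B g) : f = g := by
  have h1 := hf.gap hψ hg.1
  have h2 := hg.2 f hf.1
  have h3 : ‖f - g‖ ^ 2 ≤ 0 := by
    by_contra hcon
    have : 0 < lam / 2 * ‖f - g‖ ^ 2 := mul_pos (by linarith) (by linarith)
    linarith
  have h4 : ‖f - g‖ = 0 := by
    have := le_antisymm h3 (sq_nonneg _)
    exact pow_eq_zero_iff (two_ne_zero) |>.1 this
  exact sub_eq_zero.1 (norm_eq_zero.1 h4)

/-- Stability of regularized minimizers under a change of the convex functional. -/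
lemma IsBallMinimizer.stability {ψ ψ' : H → ℝ} (hψ : ConvexOn ℝ univ ψ)
    (hψ' : ConvexOn ℝ univ ψ') {lam B : ℝ} {f g : H}
    (hf : IsBallMinimizer ψ lam B f) (hg : IsBallMinimizer ψ' lam B g) :
    lam * ‖f - g‖ ^ 2 ≤ (ψ g - ψ' g) + (ψ' f - ψ f) := by
  have h1 := hf.gap hψ hg.1
  have h2 := hg.gap hψ' hf.1
  rw [norm_sub_rev] at h2
  linarith

lemma exists_isBallMinimizer [CompleteSpace H] {ψ : H → ℝ} (hψ : ConvexOn ℝ univ ψ)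
    (hcont : Continuous ψ) (hnonneg : ∀ f, 0 ≤ ψ f) {lam B : ℝ} (hlam : 0 < lam) (hB : 0 ≤ B) :
    ∃ f, IsBallMinimizer ψ lam B f := by
  set J : H → ℝ := fun f => ψ f + lam * ‖f‖ ^ 2 with hJ
  have hJcont : Continuous J := by fun_prop
  set S : Set ℝ := J '' Metric.closedBall 0 B
  have hSne : S.Nonempty := ⟨J 0, 0, by simpa using hB, rfl⟩
  have hSbdd : BddBelow S := ⟨0, by
    rintro _ ⟨f, -, rfl⟩
    have := hnonneg f
    simp only [hJ]; positivity⟩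
  obtain ⟨u, -, hu, huS⟩ := exists_seq_tendsto_sInf hSne hSbdd
  choose v hvB hvJ using huS
  have hvn : ∀ n, ‖v n‖ ≤ B := fun n => by simpa using hvB n
  have hinf : ∀ g : H, ‖g‖ ≤ B → sInf S ≤ J g := fun g hg =>
    csInf_le hSbdd ⟨g, by simpa using hg, rfl⟩
  have hcauchy : CauchySeq v := by
    rw [Metric.cauchySeq_iff']
    intro e he
    have hev : ∀ᶠ n in atTop, u n < sInf S + lam * e ^ 2 / 8 :=
      hu.eventually_lt_const (by have : 0 < lam * e ^ 2 := by positivity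
                                 linarith)
    obtain ⟨N, hN⟩ := eventually_atTop.1 hev
    refine ⟨N, fun n hn => ?_⟩
    have h1 := regularized_midpoint_le hψ lam (v n) (v N)
    have h2 := hinf _ (midpoint_mem_closedBall (hvn n) (hvn N))
    have h3 := hN n hn
    have h4 := hN N le_rfl
    rw [← hvJ] at h3 h4
    simp only [hJ] at h2 h3 h4
    have h5 : lam * ‖v n - v N‖ ^ 2 < lam * e ^ 2 := by
      have : 0 < lam * e ^ 2 := by positivity
      linarith
    rw [dist_eq_norm]
    exact lt_of_pow_lt_pow_left₀ 2 he.le (lt_of_mul_lt_mul_left h5 hlam.le)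
  obtain ⟨f, hf⟩ := cauchySeq_tendsto_of_complete hcauchy
  refine ⟨f, le_of_tendsto hf.norm (Eventually.of_forall hvn), fun g hg => ?_⟩
  have hlim : Tendsto (fun n => J (v n)) atTop (𝓝 (J f)) := (hJcont.tendsto f).comp hf
  simp only [hvJ] at hlim
  have := tendsto_nhds_unique hlim hu
  change J f ≤ J g
  rw [this]
  exact hinf g hg

end Minimizers

section Empirical

variable {𝒳 H : Type*} [NormedAddCommGroup H] [InnerProductSpace ℝ H]

/-- The empirical risk of the hypothesis `x ↦ ⟪f, Φ x⟫` on the sample `D`. -/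
noncomputable def empRisk (l : ℝ → ℝ) (Φ : 𝒳 → H) {n : ℕ} (D : Fin n → 𝒳 × ℝ) (f : H) : ℝ :=
  (1 / n : ℝ) * ∑ i, l ((D i).2 - ⟪f, Φ (D i).1⟫)

lemma convexOn_loss {l : ℝ → ℝ} (hl : ConvexOn ℝ univ l) (y : ℝ) (v : H) :
    ConvexOn ℝ univ fun f : H => l (y - ⟪f, v⟫) := by
  refine ⟨convex_univ, fun f _ g _ a b ha hb hab => ?_⟩
  have h := hl.2 (mem_univ (y - ⟪f, v⟫)) (mem_univ (y - ⟪g, v⟫)) ha hb hab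
  have e : y - ⟪a • f + b • g, v⟫ = a • (y - ⟪f, v⟫) + b • (y - ⟪g, v⟫) := by
    rw [inner_add_left, real_inner_smul_left, real_inner_smul_left, smul_eq_mul, smul_eq_mul]
    linear_combination -y * hab
  simp only [e]
  exact h

lemma convexOn_empRisk {l : ℝ → ℝ} (hl : ConvexOn ℝ univ l) (Φ : 𝒳 → H) {n : ℕ}
    (D : Fin n → 𝒳 × ℝ) : ConvexOn ℝ univ (empRisk l Φ D) := by
  have : ConvexOn ℝ univ (∑ i, fun f : H => l ((D i).2 - ⟪f, Φ (D i).1⟫)) := by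
    refine Finset.sum_induction _ (fun φ : H → ℝ => ConvexOn ℝ univ φ) (fun _ _ => ConvexOn.add)
      (convexOn_const 0 convex_univ) fun i _ => convexOn_loss hl _ _
  have := this.smul (by positivity : (0 : ℝ) ≤ 1 / n)
  refine this.congr fun f _ => ?_
  simp [empRisk]

lemma empRisk_nonneg {l : ℝ → ℝ} (hl : ∀ r, 0 ≤ l r) (Φ : 𝒳 → H) {n : ℕ}
    (D : Fin n → 𝒳 × ℝ) (f : H) : 0 ≤ empRisk l Φ D f :=
  mul_nonneg (by positivity) (Finset.sum_nonneg fun _ _ => hl _)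

lemma continuous_empRisk {l : ℝ → ℝ} (hl : Continuous l) (Φ : 𝒳 → H) {n : ℕ}
    (D : Fin n → 𝒳 × ℝ) : Continuous (empRisk l Φ D) := by
  unfold empRisk
  fun_prop

lemma abs_inner_le_mul {κ B : ℝ} {f v : H} (hf : ‖f‖ ≤ B) (hv : ‖v‖ ≤ κ) :
    |⟪f, v⟫| ≤ κ * B := by
  have := norm_nonneg f
  calc |⟪f, v⟫| ≤ ‖f‖ * ‖v‖ := abs_real_inner_le_norm f v
    _ ≤ B * κ := by gcongr; linarith
    _ = κ * B := mul_comm _ _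

/-- Ball minimizers of the regularized empirical risk depend continuously on the sample. -/
lemma continuous_of_isBallMinimizer [TopologicalSpace 𝒳] {l : ℝ → ℝ} (hl : ConvexOn ℝ univ l)
    {p C : ℝ} (hp : 1 ≤ p)
    (hC : 0 < C) (hLip : ∀ a b : ℝ, |l a - l b| ≤ C * (1 + |a| + |b|) ^ (p - 1) * |a - b|)
    {Φ : 𝒳 → H} (hΦ : Continuous Φ) {κ : ℝ} (hκ : ∀ x, ‖Φ x‖ ≤ κ) {lam B : ℝ}
    (hlam : 0 < lam) {n : ℕ} {F : (Fin n → 𝒳 × ℝ) → H}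
    (hF : ∀ D, IsBallMinimizer (empRisk l Φ D) lam B (F D)) : Continuous F := by
  set β : (Fin n → 𝒳 × ℝ) → (Fin n → 𝒳 × ℝ) → ℝ := fun D D' =>
    (1 / n : ℝ) * ∑ i, C * (1 + |(D i).2| + |(D' i).2| + 2 * (κ * B)) ^ (p - 1) *
      (|(D i).2 - (D' i).2| + B * ‖Φ (D i).1 - Φ (D' i).1‖) with hβ
  have hdiff : ∀ D D' (f : H), ‖f‖ ≤ B → |empRisk l Φ D f - empRisk l Φ D' f| ≤ β D D' := by
    intro D D' f hf
    have hB : 0 ≤ B := (norm_nonneg f).trans hf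
    simp only [empRisk, hβ]
    rw [← mul_sub, ← Finset.sum_sub_distrib, abs_mul, abs_of_nonneg (by positivity : (0:ℝ) ≤ 1 / n)]
    refine mul_le_mul_of_nonneg_left ((Finset.abs_sum_le_sum_abs _ _).trans
      (Finset.sum_le_sum fun i _ => ?_)) (by positivity)
    have a1 := abs_inner_le_mul hf (hκ (D i).1)
    have a2 := abs_inner_le_mul hf (hκ (D' i).1)
    have b1 := abs_sub (D i).2 ⟪f, Φ (D i).1⟫
    have b2 := abs_sub (D' i).2 ⟪f, Φ (D' i).1⟫
    have hd : |(D i).2 - ⟪f, Φ (D i).1⟫ - ((D' i).2 - ⟪f, Φ (D' i).1⟫)| ≤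
        |(D i).2 - (D' i).2| + B * ‖Φ (D i).1 - Φ (D' i).1‖ := by
      have e : (D i).2 - ⟪f, Φ (D i).1⟫ - ((D' i).2 - ⟪f, Φ (D' i).1⟫) =
          ((D i).2 - (D' i).2) - ⟪f, Φ (D i).1 - Φ (D' i).1⟫ := by
        rw [inner_sub_right]; ring
      rw [e]
      refine (abs_sub _ _).trans (add_le_add le_rfl ((abs_real_inner_le_norm _ _).trans ?_))
      gcongr
    exact abs_sub_le_of_growth_lipschitz hp hC hLip (by linarith) hd
  rw [continuous_iff_continuousAt]
  intro D
  have hβcont : Continuous fun D' => β D D' := by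
    simp only [hβ]
    refine continuous_const.mul (continuous_finsetSum _ fun i _ => ?_)
    refine Continuous.mul (continuous_const.mul ?_) (by fun_prop)
    exact Continuous.rpow_const (by fun_prop) fun _ => Or.inr (by linarith)
  have hβ0 : β D D = 0 := by simp [hβ]
  have hsq : ∀ D', ‖F D' - F D‖ ^ 2 ≤ 2 / lam * β D D' := by
    intro D'
    have h := (hF D).stability (convexOn_empRisk hl Φ D) (convexOn_empRisk hl Φ D') (hF D')
    have h1 := (abs_le.1 (hdiff D D' (F D') (hF D').1)).2
    have h2 := (abs_le.1 (hdiff D D' (F D) (hF D).1)).1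
    rw [norm_sub_rev, div_mul_eq_mul_div, le_div_iff₀ hlam]
    linarith
  have hlim : Tendsto (fun D' => √(2 / lam * β D D')) (𝓝 D) (𝓝 0) := by
    have : Continuous fun D' => √(2 / lam * β D D') := by fun_prop
    simpa [hβ0] using this.tendsto D
  rw [ContinuousAt, tendsto_iff_norm_sub_tendsto_zero]
  refine squeeze_zero (fun _ => norm_nonneg _) (fun D' => ?_) hlim
  exact Real.le_sqrt_of_sq_le (hsq D')

end Empirical

lemma le_rpow_mul_rpow_of_le {t x y s : ℝ} (ht : 0 ≤ t) (hx : t ≤ x) (hy : t ≤ y) (hs0 : 0 ≤ s)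
    (hs1 : s ≤ 1) : t ≤ x ^ (1 - s) * y ^ s := by
  calc t = t ^ (1 - s) * t ^ s := by
        rw [← Real.rpow_add_of_nonneg ht (by linarith) hs0]; simp
    _ ≤ x ^ (1 - s) * y ^ s :=
        mul_le_mul (Real.rpow_le_rpow ht hx (by linarith)) (Real.rpow_le_rpow ht hy hs0)
          (by positivity) (Real.rpow_nonneg (ht.trans hx) _)

section Stability

variable {𝒳 H : Type*} [NormedAddCommGroup H] [InnerProductSpace ℝ H]

/-- Replacing the `i`-th observation changes the empirical risk only through that observation. -/
lemma empRisk_sub_empRisk_update (l : ℝ → ℝ) (Φ : 𝒳 → H) {n : ℕ} (D : Fin n → 𝒳 × ℝ) (i : Fin n)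
    (z : 𝒳 × ℝ) (f : H) :
    empRisk l Φ D f - empRisk l Φ (Function.update D i z) f =
      (1 / n : ℝ) * (l ((D i).2 - ⟪f, Φ (D i).1⟫) - l (z.2 - ⟪f, Φ z.1⟫)) := by
  unfold empRisk
  rw [← mul_sub, ← Finset.sum_sub_distrib, Finset.sum_eq_single i]
  · simp
  · intro j _ hj
    simp [Function.update_of_ne hj]
  · simp

/-- The loss at a new observation changes little when that observation replaces one of the
training sample. -/
lemma loss_le_loss_of_update {l : ℝ → ℝ} (hl : ConvexOn ℝ univ l) {p C : ℝ} (hp : 1 ≤ p)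
    (hC : 0 < C) (hLip : ∀ a b : ℝ, |l a - l b| ≤ C * (1 + |a| + |b|) ^ (p - 1) * |a - b|)
    {Φ : 𝒳 → H} {κ : ℝ} (hκ1 : 1 ≤ κ) (hκ : ∀ x, ‖Φ x‖ ≤ κ) {lam B : ℝ}
    (hB : 1 ≤ B) (hlamB : 1 ≤ lam * B ^ 2) {n : ℕ} (D : Fin n → 𝒳 × ℝ) (i : Fin n)
    (z : 𝒳 × ℝ) {f g : H} (hf : IsBallMinimizer (empRisk l Φ D) lam B f)
    (hg : IsBallMinimizer (empRisk l Φ (Function.update D i z)) lam B g) :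
    l (z.2 - ⟪f, Φ z.1⟫) ≤ l (z.2 - ⟪g, Φ z.1⟫) +
      2 * κ ^ 2 * (C * (2 + 2 * κ) ^ (p - 1)) ^ (1 + 1 / p) *
        (1 + |(D i).2| + |z.2|) ^ p * (B ^ (2 * p) * (n : ℝ) ^ (-(1 / p))) := by
  have hn : (0 : ℝ) < n := by exact_mod_cast i.pos
  have hp0 : 0 < p := by linarith
  have hlam : 0 < lam := by
    by_contra h
    have : lam * B ^ 2 ≤ 0 := mul_nonpos_of_nonpos_of_nonneg (not_lt.1 h) (sq_nonneg _)
    linarith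
  have hs1 : 1 / p ≤ 1 := by rw [div_le_one hp0]; exact hp
  have hs0 : 0 ≤ 1 / p := by positivity
  set U := 1 + |(D i).2| + |z.2|
  have hU1 : 1 ≤ U := by have := abs_nonneg (D i).2; have := abs_nonneg z.2; linarith
  have hU0 : 0 < U := by linarith
  have hB0 : 0 < B := by linarith
  set C₁ := C * (2 + 2 * κ) ^ (p - 1) with hC₁
  have hC₁0 : 0 < C₁ := by positivity
  set M := C₁ * (U * B) ^ (p - 1) with hM
  have hM0 : 0 < M := by positivity
  set t := ‖f - g‖
  have ht0 : 0 ≤ t := norm_nonneg _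
  have hloss : ∀ w : 𝒳 × ℝ, 1 + |w.2| ≤ U →
      |l (w.2 - ⟪f, Φ w.1⟫) - l (w.2 - ⟪g, Φ w.1⟫)| ≤ M * (κ * t) := by
    intro w hw
    have a1 := abs_inner_le_mul hf.1 (hκ w.1)
    have a2 := abs_inner_le_mul hg.1 (hκ w.1)
    have b1 := abs_sub w.2 ⟪f, Φ w.1⟫
    have b2 := abs_sub w.2 ⟪g, Φ w.1⟫
    have hR : 1 + |w.2 - ⟪f, Φ w.1⟫| + |w.2 - ⟪g, Φ w.1⟫| ≤ (2 + 2 * κ) * (U * B) := by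
      have h1 : U ≤ U * B := le_mul_of_one_le_right hU0.le hB
      have h2 : κ * B ≤ κ * (U * B) :=
        mul_le_mul_of_nonneg_left (le_mul_of_one_le_left hB0.le hU1) (by linarith)
      linarith
    have hδ : |w.2 - ⟪f, Φ w.1⟫ - (w.2 - ⟪g, Φ w.1⟫)| ≤ κ * t := by
      have e : w.2 - ⟪f, Φ w.1⟫ - (w.2 - ⟪g, Φ w.1⟫) = -⟪f - g, Φ w.1⟫ := by
        rw [inner_sub_left]; ring
      rw [e, abs_neg]
      exact abs_inner_le_mul le_rfl (hκ w.1)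
    have := abs_sub_le_of_growth_lipschitz hp hC hLip hR hδ
    rw [Real.mul_rpow (by linarith) (by positivity)] at this
    refine this.trans (le_of_eq ?_)
    rw [hM, hC₁]; ring
  clear_value C₁
  have hz := hloss z (by have := abs_nonneg (D i).2; linarith)
  have hDi := hloss (D i) (by have := abs_nonneg z.2; linarith)
  have hstab := hf.stability (convexOn_empRisk hl Φ D) (convexOn_empRisk hl Φ _) hg
  rw [empRisk_sub_empRisk_update, ← neg_sub (empRisk l Φ D f), empRisk_sub_empRisk_update] at hstab
  have hquad : lam * t ^ 2 ≤ (1 / n : ℝ) * (2 * (M * (κ * t))) := by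
    refine hstab.trans ?_
    rw [← mul_neg, ← mul_add]
    refine mul_le_mul_of_nonneg_left ?_ (by positivity)
    have := (abs_le.1 hz).2
    have := (abs_le.1 hDi).1
    linarith
  have hty : t ≤ 2 * κ * M * B ^ 2 / n := by
    rcases ht0.eq_or_lt with h0 | h0
    · rw [← h0]; positivity
    · have h1 : lam * t ≤ 2 * κ * M / n := by
        refine le_of_mul_le_mul_right ?_ h0
        calc lam * t * t = lam * t ^ 2 := by ring
          _ ≤ _ := hquad
          _ = 2 * κ * M / n * t := by ring
      calc t ≤ (lam * B ^ 2) * t := le_mul_of_one_le_left ht0 hlamB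
        _ = (lam * t) * B ^ 2 := by ring
        _ ≤ 2 * κ * M / n * B ^ 2 := by gcongr
        _ = _ := by ring
  have htx : t ≤ 2 * B := (norm_sub_le _ _).trans (by linarith [hf.1, hg.1])
  have htb := le_rpow_mul_rpow_of_le ht0 htx hty hs0 hs1
  have hMB : M * B ≤ C₁ * (U ^ (p - 1) * B ^ p) := by
    rw [hM, Real.mul_rpow hU0.le hB0.le]
    have : B ^ (p - 1) * B = B ^ p := by rw [← Real.rpow_add_one hB0.ne']; simp
    rw [← this]
    exact le_of_eq (by ring)
  have hpow : (M * B) ^ (1 + 1 / p) ≤ C₁ ^ (1 + 1 / p) * (U ^ p * B ^ (2 * p)) := by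
    calc (M * B) ^ (1 + 1 / p) ≤ (C₁ * (U ^ (p - 1) * B ^ p)) ^ (1 + 1 / p) :=
          Real.rpow_le_rpow (by positivity) hMB (by positivity)
      _ = C₁ ^ (1 + 1 / p) * (U ^ ((p - 1) * (1 + 1 / p)) * B ^ (p * (1 + 1 / p))) := by
          rw [Real.mul_rpow hC₁0.le (by positivity), Real.mul_rpow (by positivity) (by positivity),
            ← Real.rpow_mul hU0.le, ← Real.rpow_mul hB0.le]
      _ ≤ _ := by
          have h1 : (p - 1) * (1 + 1 / p) = p - 1 / p := by field_simp; ring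
          have h2 : p * (1 + 1 / p) = p + 1 := by field_simp
          have h3 := Real.rpow_le_rpow_of_exponent_le hU1
            (by linarith : (p - 1) * (1 + 1 / p) ≤ p)
          have h4 := Real.rpow_le_rpow_of_exponent_le hB
            (by linarith : p * (1 + 1 / p) ≤ 2 * p)
          gcongr
  have hfinal : M * (κ * t) ≤ 2 * κ ^ 2 * C₁ ^ (1 + 1 / p) * U ^ p *
      (B ^ (2 * p) * (n : ℝ) ^ (-(1 / p))) := by
    have e1 : (2 * B) ^ (1 - 1 / p) * (2 * κ * M * B ^ 2 / n) ^ (1 / p) =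
        2 * B * (κ ^ (1 / p) * ((M * B) ^ (1 / p) * (n : ℝ) ^ (-(1 / p)))) := by
      have h1 : 2 * κ * M * B ^ 2 / n = (2 * B) * (κ * ((M * B) * (n : ℝ)⁻¹)) := by
        field_simp
      rw [h1, Real.mul_rpow (x := 2 * B) (y := κ * (M * B * (n : ℝ)⁻¹)) (by positivity)
        (by positivity), ← mul_assoc, ← Real.rpow_add (by positivity), Real.mul_rpow (x := κ)
        (by positivity) (by positivity), Real.mul_rpow (x := M * B) (by positivity) (by positivity),
        Real.inv_rpow hn.le, Real.rpow_neg hn.le]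
      simp
    have hκp : κ ^ (1 / p) ≤ κ := by
      simpa using Real.rpow_le_rpow_of_exponent_le hκ1 hs1
    calc M * (κ * t) ≤
          M * (κ * (2 * B * (κ ^ (1 / p) * ((M * B) ^ (1 / p) * (n : ℝ) ^ (-(1 / p)))))) := by
            rw [← e1]; gcongr
      _ ≤ M * (κ * (2 * B * (κ * ((M * B) ^ (1 / p) * (n : ℝ) ^ (-(1 / p)))))) := by gcongr
      _ = 2 * κ ^ 2 * (M * B) ^ (1 + 1 / p) * (n : ℝ) ^ (-(1 / p)) := by
            rw [Real.rpow_add (by positivity), Real.rpow_one]; ring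
      _ ≤ 2 * κ ^ 2 * (C₁ ^ (1 + 1 / p) * (U ^ p * B ^ (2 * p))) * (n : ℝ) ^ (-(1 / p)) := by
            gcongr
      _ = _ := by ring
  linarith [(abs_le.1 hz).2]

lemma ofReal_empRisk {l : ℝ → ℝ} (hl : ∀ r, 0 ≤ l r) (Φ : 𝒳 → H) {n : ℕ} (hn : 0 < n)
    (D : Fin n → 𝒳 × ℝ) (f : H) :
    ENNReal.ofReal (empRisk l Φ D f) =
      (n : ℝ≥0∞)⁻¹ * ∑ i, ENNReal.ofReal (l ((D i).2 - ⟪f, Φ (D i).1⟫)) := by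
  rw [empRisk, ENNReal.ofReal_mul (by positivity), one_div,
    ENNReal.ofReal_inv_of_pos (by exact_mod_cast hn), ENNReal.ofReal_natCast,
    ENNReal.ofReal_sum_of_nonneg fun _ _ => hl _]

end Stability

section Expectation

lemma lintegral_pi_update {Z : Type*} [MeasurableSpace Z] (P : Measure Z) [IsProbabilityMeasure P]
    {n : ℕ} (i : Fin n) {G : (Fin n → Z) → ℝ≥0∞} (hG : Measurable G) :
    ∫⁻ D, ∫⁻ z, G (Function.update D i z) ∂P ∂(Measure.pi fun _ : Fin n => P) =
      ∫⁻ D, G D ∂(Measure.pi fun _ : Fin n => P) := by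
  have hmeas : Measurable fun D : Fin n → Z => ∫⁻ z, G (Function.update D i z) ∂P := by
    have := hG.lmarginal (fun _ : Fin n => P) (s := {i})
    simpa only [lmarginal_singleton] using this
  refine lintegral_eq_of_lmarginal_eq {i} hmeas hG ?_
  ext x
  simp only [lmarginal_singleton, Function.update_idem, lintegral_const, measure_univ, mul_one]

variable {𝒳 H : Type*} [NormedAddCommGroup H] [InnerProductSpace ℝ H]
  [TopologicalSpace 𝒳] [SecondCountableTopology 𝒳] [MeasurableSpace 𝒳] [BorelSpace 𝒳]

/-- The risk of the hypothesis `x ↦ ⟪f, Φ x⟫`. -/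
noncomputable def risk (l : ℝ → ℝ) (Φ : 𝒳 → H) (P : Measure (𝒳 × ℝ)) (f : H) : ℝ≥0∞ :=
  ∫⁻ z, ENNReal.ofReal (l (z.2 - ⟪f, Φ z.1⟫)) ∂P

/-- The mean empirical risk of a fixed hypothesis is its risk. -/
lemma lintegral_ofReal_empRisk {l : ℝ → ℝ} (hl : ∀ r, 0 ≤ l r) (hlcont : Continuous l)
    {Φ : 𝒳 → H} (hΦ : Continuous Φ) (P : Measure (𝒳 × ℝ)) [IsProbabilityMeasure P] {n : ℕ}
    (hn : 0 < n) (f : H) :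
    ∫⁻ D, ENNReal.ofReal (empRisk l Φ D f) ∂(Measure.pi fun _ : Fin n => P) = risk l Φ P f := by
  have hm : Measurable fun z : 𝒳 × ℝ => ENNReal.ofReal (l (z.2 - ⟪f, Φ z.1⟫)) :=
    ENNReal.measurable_ofReal.comp (Continuous.measurable (by fun_prop))
  simp_rw [ofReal_empRisk hl Φ hn]
  rw [lintegral_const_mul _ (by fun_prop), lintegral_finsetSum _ (by fun_prop)]
  have : ∀ i : Fin n, ∫⁻ D : Fin n → 𝒳 × ℝ, ENNReal.ofReal (l ((D i).2 - ⟪f, Φ (D i).1⟫))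
      ∂(Measure.pi fun _ : Fin n => P) = risk l Φ P f := fun i =>
    (measurePreserving_eval (fun _ : Fin n => P) i).lintegral_comp hm
  simp only [this, Finset.sum_const, Finset.card_univ, Fintype.card_fin, nsmul_eq_mul]
  rw [← mul_assoc, ENNReal.inv_mul_cancel (by exact_mod_cast hn.ne') (by simp), one_mul]

/-- The mean risk of a continuous data-dependent hypothesis `F` that is stable under replacement of
the `i`-th observation exceeds the mean loss at that observation by at most a stability term. -/
lemma lintegral_risk_le_of_stable {l : ℝ → ℝ} (hl0 : ∀ r, 0 ≤ l r) (hlcont : Continuous l)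
    {Φ : 𝒳 → H} (hΦ : Continuous Φ) (P : Measure (𝒳 × ℝ)) [IsProbabilityMeasure P]
    {n : ℕ} {F : (Fin n → 𝒳 × ℝ) → H} (hFc : Continuous F) (i : Fin n) {p K : ℝ} (hp : 0 ≤ p)
    (hK0 : 0 ≤ K)
    (hstab : ∀ D z, l (z.2 - ⟪F D, Φ z.1⟫) ≤ l (z.2 - ⟪F (Function.update D i z), Φ z.1⟫) +
      K * (1 + |(D i).2| + |z.2|) ^ p) :
    ∫⁻ D, risk l Φ P (F D) ∂(Measure.pi fun _ : Fin n => P) ≤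
      ∫⁻ D, ENNReal.ofReal (l ((D i).2 - ⟪F D, Φ (D i).1⟫)) ∂(Measure.pi fun _ : Fin n => P) +
        ENNReal.ofReal K * ∫⁻ z, ∫⁻ z', ENNReal.ofReal ((1 + |z.2| + |z'.2|) ^ p) ∂P ∂P := by
  set G : (Fin n → 𝒳 × ℝ) → ℝ≥0∞ := fun D =>
    ENNReal.ofReal (l ((D i).2 - ⟪F D, Φ (D i).1⟫)) with hG
  have hGm : Measurable G :=
    ENNReal.measurable_ofReal.comp (Continuous.measurable (by fun_prop))
  have hGu : ∀ D, Measurable fun z => G (Function.update D i z) := fun D =>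
    hGm.comp (measurable_update D)
  have hUc : Continuous fun q : (𝒳 × ℝ) × (𝒳 × ℝ) => (1 + |q.1.2| + |q.2.2|) ^ p :=
    Continuous.rpow_const (by fun_prop) fun _ => Or.inr hp
  have hUz : ∀ y : ℝ, Measurable fun z' : 𝒳 × ℝ => ENNReal.ofReal ((1 + |y| + |z'.2|) ^ p) := by
    intro y
    have : Continuous fun z' : 𝒳 × ℝ => (1 + |y| + |z'.2|) ^ p :=
      Continuous.rpow_const (by fun_prop) fun _ => Or.inr hp
    exact ENNReal.measurable_ofReal.comp this.measurable
  have hUmeas : Measurable fun q : (𝒳 × ℝ) × (𝒳 × ℝ) =>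
      ENNReal.ofReal ((1 + |q.1.2| + |q.2.2|) ^ p) :=
    ENNReal.measurable_ofReal.comp hUc.measurable
  set V : 𝒳 × ℝ → ℝ≥0∞ := fun z => ∫⁻ z', ENNReal.ofReal ((1 + |z.2| + |z'.2|) ^ p) ∂P with hV
  have hVm : Measurable V := hUmeas.lintegral_prod_right'
  have hVD : Measurable fun D : Fin n → 𝒳 × ℝ => V (D i) := hVm.comp (measurable_pi_apply i)
  have hVi : ∫⁻ D : Fin n → 𝒳 × ℝ, V (D i) ∂(Measure.pi fun _ : Fin n => P) = ∫⁻ z, V z ∂P :=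
    (measurePreserving_eval (fun _ : Fin n => P) i).lintegral_comp hVm
  calc ∫⁻ D, risk l Φ P (F D) ∂(Measure.pi fun _ : Fin n => P)
      ≤ ∫⁻ D, (∫⁻ z, G (Function.update D i z) ∂P + ENNReal.ofReal K * V (D i))
          ∂(Measure.pi fun _ : Fin n => P) := by
        refine lintegral_mono fun D => ?_
        simp only [hV]
        rw [← lintegral_const_mul _ (hUz _), ← lintegral_add_left (hGu D)]
        refine lintegral_mono fun z => ?_
        simp only [hG, Function.update_self]
        rw [← ENNReal.ofReal_mul hK0, ← ENNReal.ofReal_add (hl0 _) (by positivity)]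
        exact ENNReal.ofReal_le_ofReal (hstab D z)
    _ = _ := by
        rw [lintegral_add_right _ (hVD.const_mul _), lintegral_const_mul _ hVD, hVi,
          lintegral_pi_update P i hGm]

/-- The mean risk of the ball minimizer exceeds the regularized risk of any competitor by at most a
stability term. -/
lemma lintegral_risk_ballMinimizer_le {l : ℝ → ℝ} (hl0 : ∀ r, 0 ≤ l r) (hl : ConvexOn ℝ univ l)
    {p C : ℝ} (hp : 1 ≤ p)
    (hC : 0 < C) (hLip : ∀ a b : ℝ, |l a - l b| ≤ C * (1 + |a| + |b|) ^ (p - 1) * |a - b|)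
    {Φ : 𝒳 → H} (hΦ : Continuous Φ) {κ : ℝ} (hκ1 : 1 ≤ κ) (hκ : ∀ x, ‖Φ x‖ ≤ κ) {lam B : ℝ}
    (hlam : 0 < lam)
    (hB : 1 ≤ B) (hlamB : 1 ≤ lam * B ^ 2) (P : Measure (𝒳 × ℝ)) [IsProbabilityMeasure P]
    {n : ℕ} (hn : 0 < n) {F : (Fin n → 𝒳 × ℝ) → H}
    (hF : ∀ D, IsBallMinimizer (empRisk l Φ D) lam B (F D)) {g : H} (hg : ‖g‖ ≤ B) :
    ∫⁻ D, risk l Φ P (F D) ∂(Measure.pi fun _ : Fin n => P) ≤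
      risk l Φ P g + ENNReal.ofReal (lam * ‖g‖ ^ 2) +
      ENNReal.ofReal (2 * κ ^ 2 * (C * (2 + 2 * κ) ^ (p - 1)) ^ (1 + 1 / p) *
        (B ^ (2 * p) * (n : ℝ) ^ (-(1 / p)))) *
        ∫⁻ z, ∫⁻ z', ENNReal.ofReal ((1 + |z.2| + |z'.2|) ^ p) ∂P ∂P := by
  set K := 2 * κ ^ 2 * (C * (2 + 2 * κ) ^ (p - 1)) ^ (1 + 1 / p) *
        (B ^ (2 * p) * (n : ℝ) ^ (-(1 / p))) with hK
  set Q := ∫⁻ z, ∫⁻ z', ENNReal.ofReal ((1 + |z.2| + |z'.2|) ^ p) ∂P ∂P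
  have hK0 : 0 ≤ K := by positivity
  have hFc : Continuous F := continuous_of_isBallMinimizer hl hp hC hLip hΦ hκ hlam hF
  have hlcont : Continuous l := by
    simpa [continuousOn_univ] using hl.continuousOn isOpen_univ
  have hone : ∀ i : Fin n, ∫⁻ D, risk l Φ P (F D) ∂(Measure.pi fun _ : Fin n => P) ≤
      ∫⁻ D, ENNReal.ofReal (l ((D i).2 - ⟪F D, Φ (D i).1⟫)) ∂(Measure.pi fun _ : Fin n => P) +
        ENNReal.ofReal K * Q := by
    intro i
    refine lintegral_risk_le_of_stable hl0 hlcont hΦ P hFc i (by linarith) hK0 fun D z => ?_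
    have h := loss_le_loss_of_update hl hp hC hLip hκ1 hκ hB hlamB D i z (hF D) (hF _)
    refine h.trans (le_of_eq ?_)
    rw [hK]; ring
  have hn0 : (n : ℝ≥0∞) ≠ 0 := by exact_mod_cast hn.ne'
  have hnt : (n : ℝ≥0∞) ≠ ∞ := by simp
  have hsum : ∫⁻ D, risk l Φ P (F D) ∂(Measure.pi fun _ : Fin n => P) ≤
      ∫⁻ D, ENNReal.ofReal (empRisk l Φ D (F D)) ∂(Measure.pi fun _ : Fin n => P) +
        ENNReal.ofReal K * Q := by
    have hmi : ∀ i : Fin n, Measurable fun D : Fin n → 𝒳 × ℝ =>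
        ENNReal.ofReal (l ((D i).2 - ⟪F D, Φ (D i).1⟫)) := fun i =>
      ENNReal.measurable_ofReal.comp (Continuous.measurable (by fun_prop))
    have h := Finset.sum_le_sum fun (i : Fin n) (_ : i ∈ Finset.univ) => hone i
    rw [Finset.sum_add_distrib, Finset.sum_const, Finset.sum_const, Finset.card_univ,
      Fintype.card_fin, nsmul_eq_mul, nsmul_eq_mul,
      ← lintegral_finsetSum _ fun i _ => hmi i] at h
    have h2 := mul_le_mul_right h (n : ℝ≥0∞)⁻¹
    rw [mul_add, ← mul_assoc, ← mul_assoc, ENNReal.inv_mul_cancel hn0 hnt, one_mul, one_mul,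
      ← lintegral_const_mul _ (Finset.measurable_fun_sum _ fun i _ => hmi i)] at h2
    simpa only [ofReal_empRisk hl0 Φ hn] using h2
  refine hsum.trans (add_le_add_left ?_ _)
  calc ∫⁻ D, ENNReal.ofReal (empRisk l Φ D (F D)) ∂(Measure.pi fun _ : Fin n => P)
      ≤ ∫⁻ D, (ENNReal.ofReal (empRisk l Φ D g) + ENNReal.ofReal (lam * ‖g‖ ^ 2))
          ∂(Measure.pi fun _ : Fin n => P) := by
        refine lintegral_mono fun D => ?_
        rw [← ENNReal.ofReal_add (empRisk_nonneg hl0 Φ D g) (by positivity)]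
        refine ENNReal.ofReal_le_ofReal ?_
        have h1 := (hF D).2 g hg
        have h2 : 0 ≤ lam * ‖F D‖ ^ 2 := by positivity
        linarith
    _ = _ := by
        rw [lintegral_add_right _ measurable_const, lintegral_ofReal_empRisk hl0 hlcont hΦ P hn]
        simp

end Expectation

section Approximation

lemma add_rpow_le_two_rpow_mul {a b p : ℝ} (ha : 0 ≤ a) (hb : 0 ≤ b) (hp : 0 ≤ p) :
    (a + b) ^ p ≤ 2 ^ p * (a ^ p + b ^ p) := by
  have key : ∀ {u v : ℝ}, 0 ≤ u → u ≤ v → (u + v) ^ p ≤ 2 ^ p * (u ^ p + v ^ p) := by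
    intro u v hu huv
    have hv := hu.trans huv
    calc (u + v) ^ p ≤ (2 * v) ^ p := Real.rpow_le_rpow (by positivity) (by linarith) hp
      _ = 2 ^ p * v ^ p := Real.mul_rpow (by norm_num) hv
      _ ≤ 2 ^ p * (u ^ p + v ^ p) := by
          gcongr; linarith [Real.rpow_nonneg hu p]
  rcases le_total a b with h | h
  · exact key ha h
  · rw [add_comm a, add_comm (a ^ p)]; exact key hb h

variable {𝒳 : Type*} [MeasurableSpace 𝒳]

lemma lintegral_ofReal_add_abs_rpow_ne_top {P : Measure (𝒳 × ℝ)} [IsProbabilityMeasure P] {p q : ℝ}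
    (hq : 0 ≤ q) (hqp : q ≤ p) (hPp : Integrable (fun z : 𝒳 × ℝ => |z.2| ^ p) P)
    {a : ℝ} (ha : 1 ≤ a) : ∫⁻ z, ENNReal.ofReal ((a + |z.2|) ^ q) ∂P ≠ ∞ := by
  have hI : Integrable (fun z : 𝒳 × ℝ => 2 ^ p * (a ^ p + |z.2| ^ p)) P :=
    ((integrable_const _).add hPp).const_mul _
  have h := hI.lintegral_lt_top
  refine ne_of_lt (lt_of_le_of_lt (lintegral_mono fun z => ENNReal.ofReal_le_ofReal ?_) h)
  have h1 : 1 ≤ a + |z.2| := by linarith [abs_nonneg z.2]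
  exact (Real.rpow_le_rpow_of_exponent_le h1 hqp).trans
    (add_rpow_le_two_rpow_mul (by linarith) (abs_nonneg _) (hq.trans hqp))

lemma lintegral_lintegral_ofReal_add_abs_rpow_ne_top {P : Measure (𝒳 × ℝ)} [IsProbabilityMeasure P]
    {p : ℝ} (hp : 0 ≤ p) (hPp : Integrable (fun z : 𝒳 × ℝ => |z.2| ^ p) P) :
    ∫⁻ z, ∫⁻ z', ENNReal.ofReal ((1 + |z.2| + |z'.2|) ^ p) ∂P ∂P ≠ ∞ := by
  have h1 := lintegral_ofReal_add_abs_rpow_ne_top hp le_rfl hPp le_rfl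
  have hm : Measurable fun z : 𝒳 × ℝ => ENNReal.ofReal ((1 + |z.2|) ^ p) := by fun_prop
  have hle : ∀ z : 𝒳 × ℝ, ∫⁻ z', ENNReal.ofReal ((1 + |z.2| + |z'.2|) ^ p) ∂P ≤
      ENNReal.ofReal (2 ^ p) * ENNReal.ofReal ((1 + |z.2|) ^ p) +
        ENNReal.ofReal (2 ^ p) * ∫⁻ z', ENNReal.ofReal ((1 + |z'.2|) ^ p) ∂P := by
    intro z
    calc ∫⁻ z', ENNReal.ofReal ((1 + |z.2| + |z'.2|) ^ p) ∂P
        ≤ ∫⁻ z', (ENNReal.ofReal (2 ^ p) * ENNReal.ofReal ((1 + |z.2|) ^ p) +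
            ENNReal.ofReal (2 ^ p) * ENNReal.ofReal ((1 + |z'.2|) ^ p)) ∂P := by
          refine lintegral_mono fun z' => ?_
          rw [← ENNReal.ofReal_mul (by positivity), ← ENNReal.ofReal_mul (by positivity),
            ← ENNReal.ofReal_add (by positivity) (by positivity)]
          refine ENNReal.ofReal_le_ofReal ?_
          rw [← mul_add]
          refine (Real.rpow_le_rpow (by positivity) ?_ hp).trans
            (add_rpow_le_two_rpow_mul (a := 1 + |z.2|) (b := 1 + |z'.2|)
              (by positivity) (by positivity) hp)
          linarith
      _ = _ := by
          rw [lintegral_add_left measurable_const, lintegral_const_mul _ hm]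
          simp
  refine ne_of_lt (lt_of_le_of_lt (lintegral_mono hle) ?_)
  rw [lintegral_add_right _ measurable_const, lintegral_const_mul _ hm]
  simp only [lintegral_const, measure_univ, mul_one]
  exact ENNReal.add_lt_top.2 ⟨ENNReal.mul_lt_top ENNReal.ofReal_lt_top h1.lt_top,
    ENNReal.mul_lt_top ENNReal.ofReal_lt_top h1.lt_top⟩

lemma lintegral_ofReal_loss_ne_top {P : Measure (𝒳 × ℝ)} [IsProbabilityMeasure P] {l : ℝ → ℝ}
    {p : ℝ} (hPp : Integrable (fun z : 𝒳 × ℝ => |z.2| ^ p) P)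
    (hupper : ∃ c > (0 : ℝ), ∀ r : ℝ, l r ≤ c * (|r| ^ p + 1)) :
    ∫⁻ z, ENNReal.ofReal (l z.2) ∂P ≠ ∞ := by
  obtain ⟨c, -, hc⟩ := hupper
  have hI : Integrable (fun z : 𝒳 × ℝ => c * (|z.2| ^ p + 1)) P :=
    (hPp.add (integrable_const _)).const_mul _
  exact ne_of_lt (lt_of_le_of_lt
    (lintegral_mono fun z => ENNReal.ofReal_le_ofReal (hc z.2)) hI.lintegral_lt_top)

/-- Truncation of a real number to the interval `[-M, M]`. -/
def truncate (M t : ℝ) : ℝ := max (-M) (min M t)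

lemma continuous_truncate (M : ℝ) : Continuous (truncate M) := by
  unfold truncate; fun_prop

lemma abs_truncate_le {M : ℝ} (hM : 0 ≤ M) (t : ℝ) : |truncate M t| ≤ M := by
  rw [truncate, abs_le]
  exact ⟨le_max_left _ _, max_le (by linarith) (min_le_left _ _)⟩

lemma abs_truncate_sub_truncate_le (M s t : ℝ) : |truncate M s - truncate M t| ≤ |s - t| := by
  have h1 := abs_max_sub_max_le_max (-M) (min M s) (-M) (min M t)
  have h2 := abs_min_sub_min_le_max M s M t
  rw [sub_self, abs_zero, max_eq_right (abs_nonneg (min M s - min M t))] at h1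
  rw [sub_self, abs_zero, max_eq_right (abs_nonneg (s - t))] at h2
  exact h1.trans h2

lemma truncate_eq_self {M t : ℝ} (h : |t| ≤ M) : truncate M t = t := by
  rw [abs_le] at h
  rw [truncate, min_eq_right h.2, max_eq_right h.1]

lemma truncate_mem_uIcc {M : ℝ} (hM : 0 ≤ M) (t : ℝ) : truncate M t ∈ uIcc 0 t := by
  rw [mem_uIcc, truncate]
  rcases le_total 0 t with h | h
  · left
    exact ⟨le_max_of_le_right (le_min hM h), max_le (by linarith) (min_le_right _ _)⟩
  · right
    exact ⟨le_max_of_le_right (le_min (h.trans hM) le_rfl),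
      max_le (by linarith) ((min_le_right _ _).trans h)⟩

lemma loss_truncate_le {l : ℝ → ℝ} (hl0 : ∀ r, 0 ≤ l r) (hl : ConvexOn ℝ univ l) {M : ℝ}
    (hM : 0 ≤ M) (y t : ℝ) : l (y - truncate M t) ≤ l y + l (y - t) := by
  have hmem : y - truncate M t ∈ segment ℝ y (y - t) := by
    rw [segment_eq_uIcc, mem_uIcc]
    rcases mem_uIcc.1 (truncate_mem_uIcc hM t) with ⟨h1, h2⟩ | ⟨h1, h2⟩
    · right; constructor <;> linarith
    · left; constructor <;> linarith
  refine (hl.le_max_of_mem_segment (mem_univ _) (mem_univ _) hmem).trans (max_le ?_ ?_)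
  · linarith [hl0 (y - t)]
  · linarith [hl0 y]

/-- Truncating a hypothesis at a high level barely increases its risk. -/
lemma exists_truncate_risk_le {P : Measure (𝒳 × ℝ)} {l : ℝ → ℝ} (hl0 : ∀ r, 0 ≤ l r)
    (hl : ConvexOn ℝ univ l) (hlcont : Continuous l)
    (hfin : ∫⁻ z, ENNReal.ofReal (l z.2) ∂P ≠ ∞) {f : 𝒳 → ℝ} (hf : Measurable f)
    (hffin : ∫⁻ z, ENNReal.ofReal (l (z.2 - f z.1)) ∂P ≠ ∞) {δ : ℝ} (hδ : 0 < δ) :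
    ∃ M : ℝ, 0 ≤ M ∧ ∫⁻ z, ENNReal.ofReal (l (z.2 - truncate M (f z.1))) ∂P ≤
      ∫⁻ z, ENNReal.ofReal (l (z.2 - f z.1)) ∂P + ENNReal.ofReal δ := by
  have hlm := hlcont.measurable
  have hlim : Tendsto (fun k : ℕ => ∫⁻ z, ENNReal.ofReal (l (z.2 - truncate k (f z.1))) ∂P) atTop
      (𝓝 (∫⁻ z, ENNReal.ofReal (l (z.2 - f z.1)) ∂P)) := by
    refine tendsto_lintegral_of_dominated_convergence
      (fun z => ENNReal.ofReal (l z.2) + ENNReal.ofReal (l (z.2 - f z.1))) (fun k => ?_)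
      (fun k => Eventually.of_forall fun z => ?_) ?_ (Eventually.of_forall fun z => ?_)
    · have := (continuous_truncate k).measurable
      fun_prop
    · beta_reduce
      rw [← ENNReal.ofReal_add (hl0 _) (hl0 _)]
      exact ENNReal.ofReal_le_ofReal (loss_truncate_le hl0 hl (Nat.cast_nonneg k) _ _)
    · rw [lintegral_add_left (by fun_prop)]
      exact ENNReal.add_ne_top.2 ⟨hfin, hffin⟩
    · refine tendsto_const_nhds.congr' ?_
      filter_upwards [eventually_ge_atTop ⌈|f z.1|⌉₊] with k hk
      rw [truncate_eq_self ((Nat.le_ceil _).trans (by exact_mod_cast hk))]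
  have hlt : ∫⁻ z, ENNReal.ofReal (l (z.2 - f z.1)) ∂P <
      ∫⁻ z, ENNReal.ofReal (l (z.2 - f z.1)) ∂P + ENNReal.ofReal δ :=
    ENNReal.lt_add_right hffin (by simpa using hδ)
  obtain ⟨k, hk⟩ := (hlim.eventually_lt_const hlt).exists
  exact ⟨k, Nat.cast_nonneg k, hk.le⟩

variable {H : Type*} [NormedAddCommGroup H] [InnerProductSpace ℝ H]
  [TopologicalSpace 𝒳] [SecondCountableTopology 𝒳] [TopologicalSpace.PseudoMetrizableSpace 𝒳]
  [BorelSpace 𝒳]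

/-- Hypotheses from a universal feature map come arbitrarily close to the risk of any measurable
hypothesis. -/
lemma exists_risk_le_of_universal {P : Measure (𝒳 × ℝ)} [IsProbabilityMeasure P]
    {l : ℝ → ℝ} (hl0 : ∀ r, 0 ≤ l r)
    (hl : ConvexOn ℝ univ l) {p C : ℝ} (hp : 1 ≤ p)
    (hC : 0 < C) (hLip : ∀ a b : ℝ, |l a - l b| ≤ C * (1 + |a| + |b|) ^ (p - 1) * |a - b|)
    (hPp : Integrable (fun z : 𝒳 × ℝ => |z.2| ^ p) P)
    (hfin : ∫⁻ z, ENNReal.ofReal (l z.2) ∂P ≠ ∞) {Φ : 𝒳 → H}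
    (huniversal : ∀ g : C(𝒳, ℝ), ∀ δ > (0 : ℝ), ∃ f : H, ∀ x : 𝒳, |⟪f, Φ x⟫ - g x| < δ)
    {f : 𝒳 → ℝ} (hf : Measurable f)
    (hffin : ∫⁻ z, ENNReal.ofReal (l (z.2 - f z.1)) ∂P ≠ ∞) {δ : ℝ} (hδ : 0 < δ) :
    ∃ h : H, risk l Φ P h ≤
      ∫⁻ z, ENNReal.ofReal (l (z.2 - f z.1)) ∂P + ENNReal.ofReal δ := by
  have hlcont : Continuous l := by
    simpa [continuousOn_univ] using hl.continuousOn isOpen_univ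
  obtain ⟨M, hM, hTrisk⟩ :=
    exists_truncate_risk_le hl0 hl hlcont hfin hf hffin (by positivity : 0 < δ / 3)
  set T : 𝒳 → ℝ := fun x => truncate M (f x)
  have hTm : Measurable T := (continuous_truncate M).measurable.comp hf
  set w : 𝒳 × ℝ → ℝ := fun z => C * (2 * ((1 + M) + |z.2|)) ^ (p - 1) with hw
  have hw0 : ∀ z, 0 ≤ w z := fun z => by simp only [hw]; positivity
  have hwm : Measurable fun z => ENNReal.ofReal (w z) := by simp only [hw]; fun_prop
  have hwfin : ∫⁻ z, ENNReal.ofReal (w z) ∂P ≠ ∞ := by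
    have h := lintegral_ofReal_add_abs_rpow_ne_top (P := P) (q := p - 1) (a := 1 + M)
      (by linarith) (by linarith) hPp (by linarith)
    have e : ∀ z, ENNReal.ofReal (w z) = ENNReal.ofReal (C * 2 ^ (p - 1)) *
        ENNReal.ofReal (((1 + M) + |z.2|) ^ (p - 1)) := by
      intro z
      rw [← ENNReal.ofReal_mul (by positivity)]
      simp only [hw]
      rw [Real.mul_rpow (by norm_num) (by positivity), mul_assoc]
    simp_rw [e]
    rw [lintegral_const_mul _ (by fun_prop)]
    exact ENNReal.mul_ne_top ENNReal.ofReal_ne_top h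
  set W : ℝ := (∫⁻ z, ENNReal.ofReal (w z) ∂P).toReal
  have hW0 : 0 ≤ W := ENNReal.toReal_nonneg
  set ν : Measure 𝒳 := (P.withDensity fun z => ENNReal.ofReal (w z)).map Prod.fst with hν
  have : IsFiniteMeasure (P.withDensity fun z => ENNReal.ofReal (w z)) :=
    isFiniteMeasure_withDensity hwfin
  have : IsFiniteMeasure ν := Measure.isFiniteMeasure_map _ _
  have hTLp : MemLp T 1 ν :=
    MemLp.of_bound hTm.aestronglyMeasurable M (Eventually.of_forall fun x => by
      rw [Real.norm_eq_abs]; exact abs_truncate_le hM _)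
  obtain ⟨g, hg, -⟩ := hTLp.exists_boundedContinuous_eLpNorm_sub_le ENNReal.one_ne_top
    (ε := ENNReal.ofReal (δ / 3)) (by simpa using hδ)
  have hTg : Measurable fun x => ‖(T - ⇑g) x‖ₑ := (hTm.sub g.continuous.measurable).enorm
  rw [eLpNorm_one_eq_lintegral_enorm, hν, lintegral_map hTg measurable_fst,
    lintegral_withDensity_eq_lintegral_mul _ hwm
      (show Measurable fun z : 𝒳 × ℝ => ‖(T - ⇑g) z.1‖ₑ from hTg.comp measurable_fst)] at hg
  set δ' : ℝ := min 1 (δ / 3 / (W + 1))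
  have hδ'0 : 0 < δ' := lt_min one_pos (by positivity)
  obtain ⟨h, hh⟩ := huniversal
    ⟨fun x => truncate M (g x), (continuous_truncate M).comp g.continuous⟩ δ' hδ'0
  simp only [ContinuousMap.coe_mk] at hh
  refine ⟨h, ?_⟩
  have hpt : ∀ z : 𝒳 × ℝ, l (z.2 - ⟪h, Φ z.1⟫) ≤
      l (z.2 - T z.1) + (w z * |T z.1 - g z.1| + w z * δ') := by
    intro z
    have h1 := (hh z.1).le
    have h2 : |T z.1 - truncate M (g z.1)| ≤ |T z.1 - g z.1| := by
      have := abs_truncate_sub_truncate_le M (T z.1) (g z.1)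
      rwa [truncate_eq_self (abs_truncate_le hM (f z.1))] at this
    have h3 : |⟪h, Φ z.1⟫| ≤ M + 1 := by
      have a1 := abs_truncate_le hM (g z.1)
      have a2 := abs_sub_abs_le_abs_sub ⟪h, Φ z.1⟫ (truncate M (g z.1))
      have a3 : δ' ≤ 1 := min_le_left _ _
      linarith
    have h4 : |T z.1| ≤ M := abs_truncate_le hM _
    have b1 := abs_sub z.2 ⟪h, Φ z.1⟫
    have b2 := abs_sub z.2 (T z.1)
    have hd : |z.2 - ⟪h, Φ z.1⟫ - (z.2 - T z.1)| ≤ |T z.1 - g z.1| + δ' := by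
      have e : z.2 - ⟪h, Φ z.1⟫ - (z.2 - T z.1) =
          (T z.1 - truncate M (g z.1)) - (⟪h, Φ z.1⟫ - truncate M (g z.1)) := by ring
      rw [e]
      exact (abs_sub _ _).trans (add_le_add h2 h1)
    have hfinal := abs_sub_le_of_growth_lipschitz hp hC hLip
      (R := 2 * ((1 + M) + |z.2|)) (by linarith) hd
    have := (abs_le.1 hfinal).2
    simp only [hw]
    linarith
  have hlT : Measurable fun z : 𝒳 × ℝ => ENNReal.ofReal (l (z.2 - T z.1)) := by
    have := hlcont.measurable
    fun_prop
  calc risk l Φ P h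
      ≤ ∫⁻ z, (ENNReal.ofReal (l (z.2 - T z.1)) + (ENNReal.ofReal (w z) * ‖T z.1 - g z.1‖ₑ +
          ENNReal.ofReal (w z) * ENNReal.ofReal δ')) ∂P := by
        refine lintegral_mono fun z => ?_
        simp only [Real.enorm_eq_ofReal_abs]
        rw [← ENNReal.ofReal_mul (hw0 z), ← ENNReal.ofReal_mul (hw0 z),
          ← ENNReal.ofReal_add (mul_nonneg (hw0 z) (abs_nonneg _)) (mul_nonneg (hw0 z) hδ'0.le),
          ← ENNReal.ofReal_add (hl0 _) (add_nonneg (mul_nonneg (hw0 z) (abs_nonneg _))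
            (mul_nonneg (hw0 z) hδ'0.le))]
        exact ENNReal.ofReal_le_ofReal (hpt z)
    _ = ∫⁻ z, ENNReal.ofReal (l (z.2 - T z.1)) ∂P +
          (∫⁻ z, ENNReal.ofReal (w z) * ‖T z.1 - g z.1‖ₑ ∂P +
            (∫⁻ z, ENNReal.ofReal (w z) ∂P) * ENNReal.ofReal δ') := by
        rw [lintegral_add_left hlT, lintegral_add_right _ (hwm.mul_const _),
          lintegral_mul_const _ hwm]
    _ ≤ (∫⁻ z, ENNReal.ofReal (l (z.2 - f z.1)) ∂P + ENNReal.ofReal (δ / 3)) +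
          (ENNReal.ofReal (δ / 3) + ENNReal.ofReal (δ / 3)) := by
        refine add_le_add hTrisk (add_le_add hg ?_)
        rw [← ENNReal.ofReal_toReal hwfin, ← ENNReal.ofReal_mul hW0]
        refine ENNReal.ofReal_le_ofReal ?_
        calc W * δ' ≤ (W + 1) * (δ / 3 / (W + 1)) :=
              mul_le_mul (by linarith) (min_le_right _ _) hδ'0.le (by linarith)
          _ = δ / 3 := by field_simp
    _ = _ := by
        rw [← ENNReal.ofReal_add (by positivity) (by positivity), add_assoc,
          ← ENNReal.ofReal_add (by positivity) (by positivity)]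
        congr 2
        ring

end Approximation

section Consistency

/-- The stability rate vanishes under the growth condition on the regularization sequence. -/
lemma tendsto_sqrt_div_rpow_mul_rpow {p A : ℝ} (hp : 1 ≤ p) (hA : 0 ≤ A) {lam : ℕ → ℝ}
    (hlampos : ∀ n, 0 < lam n) (hlam0 : Tendsto lam atTop (𝓝 0))
    (hlamn : Tendsto (fun n : ℕ => lam n ^ max (2 * p) (p ^ 2) * n) atTop atTop) :
    Tendsto (fun n : ℕ => √(A / lam n) ^ (2 * p) * (n : ℝ) ^ (-(1 / p))) atTop (𝓝 0) := by
  have hp0 : 0 < p := by linarith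
  have h1 : Tendsto (fun n : ℕ => lam n ^ (p ^ 2) * n) atTop atTop := by
    refine tendsto_atTop_mono' _ ?_ hlamn
    filter_upwards [hlam0.eventually_le_const one_pos] with n hn
    exact mul_le_mul_of_nonneg_right
      (Real.rpow_le_rpow_of_exponent_ge (hlampos n) hn (le_max_right _ _)) (Nat.cast_nonneg n)
  have h2 := ((tendsto_rpow_neg_atTop (one_div_pos.2 hp0)).comp h1).const_mul (A ^ p)
  rw [mul_zero] at h2
  refine h2.congr fun n => ?_
  have hl := (hlampos n).le
  have e : (√(A / lam n)) ^ (2 * p) = A ^ p / lam n ^ p := by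
    rw [Real.rpow_mul (Real.sqrt_nonneg _), Real.rpow_two, Real.sq_sqrt (by positivity),
      Real.div_rpow hA hl]
  have e' : (lam n ^ (p ^ 2)) ^ (-(1 / p)) = (lam n ^ p)⁻¹ := by
    rw [← Real.rpow_mul hl, ← Real.rpow_neg hl]
    congr 1
    field_simp
  simp only [Function.comp_apply]
  rw [e, Real.mul_rpow (by positivity) (Nat.cast_nonneg n), e']
  ring

variable {𝒳 H : Type*} [TopologicalSpace 𝒳] [SecondCountableTopology 𝒳] [MeasurableSpace 𝒳]
  [BorelSpace 𝒳] [NormedAddCommGroup H] [InnerProductSpace ℝ H] [CompleteSpace H]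

/-- A bound on the probability that some regularized empirical minimizer has large risk. -/
lemma measure_lt_risk_minimizer_le {l : ℝ → ℝ} (hl0 : ∀ r, 0 ≤ l r) (hl : ConvexOn ℝ univ l)
    {p C : ℝ} (hp : 1 ≤ p) (hC : 0 < C)
    (hLip : ∀ a b : ℝ, |l a - l b| ≤ C * (1 + |a| + |b|) ^ (p - 1) * |a - b|)
    {Φ : 𝒳 → H} (hΦ : Continuous Φ) {κ : ℝ} (hκ1 : 1 ≤ κ) (hκ : ∀ x, ‖Φ x‖ ≤ κ)
    {lam A : ℝ} (hlam : 0 < lam) (hlam1 : lam ≤ 1) (hA : 1 ≤ A)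
    (P : Measure (𝒳 × ℝ)) [IsProbabilityMeasure P] {n : ℕ} (hn : 0 < n)
    {g : H} (hg : ‖g‖ ≤ √(A / lam)) {R : ℝ≥0∞} (hR : R ≠ ∞) (hRle : ∀ h : H, R ≤ risk l Φ P h)
    {ε τ : ℝ} (hε : 0 < ε)
    (hτ : risk l Φ P g + ENNReal.ofReal (lam * ‖g‖ ^ 2) +
      ENNReal.ofReal (2 * κ ^ 2 * (C * (2 + 2 * κ) ^ (p - 1)) ^ (1 + 1 / p) *
        (√(A / lam) ^ (2 * p) * (n : ℝ) ^ (-(1 / p)))) *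
        ∫⁻ z, ∫⁻ z', ENNReal.ofReal ((1 + |z.2| + |z'.2|) ^ p) ∂P ∂P ≤ R + ENNReal.ofReal τ) :
    (Measure.pi fun _ : Fin n => P)
      {D | ∃ f : H, (∀ h : H, empRisk l Φ D f + lam * ‖f‖ ^ 2 ≤
        empRisk l Φ D h + lam * ‖h‖ ^ 2) ∧ R + ENNReal.ofReal ε < risk l Φ P f} ≤
      risk l Φ P 0 / ENNReal.ofReal A + ENNReal.ofReal τ / ENNReal.ofReal ε := by
  have hlcont : Continuous l := by
    simpa [continuousOn_univ] using hl.continuousOn isOpen_univ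
  have hA0 : 0 < A := by linarith
  set B : ℝ := √(A / lam) with hBdef
  have hB2 : B ^ 2 = A / lam := Real.sq_sqrt (by positivity)
  have hlamB : lam * B ^ 2 = A := by rw [hB2]; field_simp
  have hB1 : 1 ≤ B := by
    rw [hBdef, Real.one_le_sqrt, one_le_div hlam]
    linarith
  choose F hF using fun D : Fin n → 𝒳 × ℝ =>
    exists_isBallMinimizer (convexOn_empRisk hl Φ D) (continuous_empRisk hlcont Φ D)
      (empRisk_nonneg hl0 Φ D) hlam (by linarith : 0 ≤ B)
  have hFc : Continuous F := continuous_of_isBallMinimizer hl hp hC hLip hΦ hκ hlam hF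
  have hmeasF : Measurable fun D => risk l Φ P (F D) := by
    refine Measurable.lintegral_prod_right'
      (f := fun q : (Fin n → 𝒳 × ℝ) × (𝒳 × ℝ) =>
        ENNReal.ofReal (l (q.2.2 - ⟪F q.1, Φ q.2.1⟫))) ?_
    exact ENNReal.measurable_ofReal.comp (Continuous.measurable (by fun_prop))
  have hmeas0 : Measurable fun D : Fin n → 𝒳 × ℝ => ENNReal.ofReal (empRisk l Φ D 0) := by
    unfold empRisk
    exact ENNReal.measurable_ofReal.comp (Continuous.measurable (by fun_prop))
  have hsub : {D : Fin n → 𝒳 × ℝ | ∃ f : H, (∀ h : H, empRisk l Φ D f + lam * ‖f‖ ^ 2 ≤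
        empRisk l Φ D h + lam * ‖h‖ ^ 2) ∧ R + ENNReal.ofReal ε < risk l Φ P f} ⊆
      {D | ENNReal.ofReal A ≤ ENNReal.ofReal (empRisk l Φ D 0)} ∪
        {D | R + ENNReal.ofReal ε ≤ risk l Φ P (F D)} := by
    rintro D ⟨f, hf, hfR⟩
    rw [mem_union, or_iff_not_imp_left]
    intro hlt
    rw [mem_ofPred_eq, not_le, ENNReal.ofReal_lt_ofReal_iff hA0] at hlt
    have h0 := hf 0
    rw [norm_zero, zero_pow two_ne_zero, mul_zero, add_zero] at h0
    have hfB : ‖f‖ ≤ B := by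
      refine Real.le_sqrt_of_sq_le ?_
      rw [le_div_iff₀ hlam]
      linarith [empRisk_nonneg hl0 Φ D f]
    have hEq : F D = f :=
      (hF D).unique (convexOn_empRisk hl Φ D) hlam ⟨hfB, fun h _ => hf h⟩
    rw [mem_ofPred_eq, hEq]
    exact hfR.le
  refine (measure_mono hsub).trans ((measure_union_le _ _).trans (add_le_add ?_ ?_))
  · rw [← lintegral_ofReal_empRisk hl0 hlcont hΦ P hn]
    exact meas_ge_le_lintegral_div hmeas0.aemeasurable (by simpa using hA0) ENNReal.ofReal_ne_top
  · have h1 := lintegral_add_mul_meas_add_le_le_lintegral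
      (μ := Measure.pi fun _ : Fin n => P) (f := fun _ => R)
      (Eventually.of_forall fun D => hRle (F D)) hmeasF.aemeasurable (ENNReal.ofReal ε)
    have h2 := (h1.trans (lintegral_risk_ballMinimizer_le hl0 hl hp hC hLip hΦ hκ1 hκ hlam hB1
        (by linarith : 1 ≤ lam * B ^ 2) P hn hF hg)).trans hτ
    rw [lintegral_const, measure_univ, mul_one, ENNReal.add_le_add_iff_left hR] at h2
    rw [ENNReal.le_div_iff_mul_le (Or.inl (by simpa using hε)) (Or.inl ENNReal.ofReal_ne_top),
      mul_comm]
    exact h2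

/-- Regularized empirical minimizers have nearly minimal risk with high probability. -/
lemma eventually_measure_lt_risk_minimizer_le {l : ℝ → ℝ} (hl0 : ∀ r, 0 ≤ l r)
    (hl : ConvexOn ℝ univ l) {p C : ℝ} (hp : 1 ≤ p) (hC : 0 < C)
    (hLip : ∀ a b : ℝ, |l a - l b| ≤ C * (1 + |a| + |b|) ^ (p - 1) * |a - b|)
    {Φ : 𝒳 → H} (hΦ : Continuous Φ) {κ : ℝ} (hκ1 : 1 ≤ κ) (hκ : ∀ x, ‖Φ x‖ ≤ κ)
    {lam : ℕ → ℝ} (hlampos : ∀ n, 0 < lam n) (hlam0 : Tendsto lam atTop (𝓝 0))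
    (hlamn : Tendsto (fun n : ℕ => lam n ^ max (2 * p) (p ^ 2) * n) atTop atTop)
    (P : Measure (𝒳 × ℝ)) [IsProbabilityMeasure P]
    (hPp : Integrable (fun z : 𝒳 × ℝ => |z.2| ^ p) P)
    (hfin : risk l Φ P 0 ≠ ∞) {R : ℝ≥0∞} (hR : R ≠ ∞) (hRle : ∀ h : H, R ≤ risk l Φ P h)
    (hRapprox : ∀ δ > (0 : ℝ), ∃ h : H, risk l Φ P h ≤ R + ENNReal.ofReal δ)
    {ε η : ℝ} (hε : 0 < ε) (hη : 0 < η) :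
    ∀ᶠ n in atTop, (Measure.pi fun _ : Fin n => P)
      {D | ∃ f : H, (∀ h : H, empRisk l Φ D f + lam n * ‖f‖ ^ 2 ≤
        empRisk l Φ D h + lam n * ‖h‖ ^ 2) ∧ R + ENNReal.ofReal ε < risk l Φ P f} ≤
      ENNReal.ofReal η := by
  set E : ℝ := (risk l Φ P 0).toReal
  have hE0 : 0 ≤ E := ENNReal.toReal_nonneg
  set A : ℝ := max 1 (2 * E / η) with hA
  have hA1 : 1 ≤ A := le_max_left _ _
  set δ : ℝ := ε * η / 6 with hδ
  have hδ0 : 0 < δ := by positivity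
  obtain ⟨g, hg⟩ := hRapprox δ hδ0
  have hQ := lintegral_lintegral_ofReal_add_abs_rpow_ne_top (by linarith : 0 ≤ p) hPp
  set Q := ∫⁻ z, ∫⁻ z', ENNReal.ofReal ((1 + |z.2| + |z'.2|) ^ p) ∂P ∂P with hQdef
  set K : ℝ := 2 * κ ^ 2 * (C * (2 + 2 * κ) ^ (p - 1)) ^ (1 + 1 / p)
  have hrate : Tendsto (fun n : ℕ => K * (√(A / lam n) ^ (2 * p) * (n : ℝ) ^ (-(1 / p))) * Q.toReal)
      atTop (𝓝 0) := by
    simpa using ((tendsto_sqrt_div_rpow_mul_rpow hp (by linarith : 0 ≤ A) hlampos hlam0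
      hlamn).const_mul K).mul_const Q.toReal
  have hlamg : Tendsto (fun n => lam n * ‖g‖ ^ 2) atTop (𝓝 0) := by
    simpa using hlam0.mul_const (‖g‖ ^ 2)
  filter_upwards [eventually_gt_atTop 0, hlam0.eventually_le_const one_pos,
    hrate.eventually_le_const hδ0, hlamg.eventually_le_const hδ0,
    hlamg.eventually_le_const one_pos] with n hn hlam1 hKn hgn hgn1
  have hgB : ‖g‖ ≤ √(A / lam n) := by
    refine Real.le_sqrt_of_sq_le ?_
    rw [le_div_iff₀ (hlampos n)]
    linarith
  refine (measure_lt_risk_minimizer_le hl0 hl hp hC hLip hΦ hκ1 hκ (hlampos n) hlam1 hA1 P hn hgB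
    hR hRle hε (τ := δ + δ + δ) ?_).trans ?_
  · rw [ENNReal.ofReal_add (by positivity) hδ0.le, ENNReal.ofReal_add hδ0.le hδ0.le, ← add_assoc,
      ← add_assoc]
    refine add_le_add (add_le_add hg (ENNReal.ofReal_le_ofReal hgn)) ?_
    rw [← hQdef, ← ENNReal.ofReal_toReal hQ, ← ENNReal.ofReal_mul (by positivity)]
    exact ENNReal.ofReal_le_ofReal hKn
  · rw [← ENNReal.ofReal_toReal hfin, ← ENNReal.ofReal_div_of_pos (by linarith),
      ← ENNReal.ofReal_div_of_pos hε, ← ENNReal.ofReal_add (by positivity) (by positivity)]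
    refine ENNReal.ofReal_le_ofReal ?_
    have h1 : E / A ≤ η / 2 := by
      have := le_max_right 1 (2 * E / η)
      rw [← hA, div_le_iff₀ hη] at this
      rw [div_le_iff₀ (by linarith)]
      linarith
    have h2 : (δ + δ + δ) / ε = η / 2 := by rw [hδ]; field_simp; ring
    linarith

end Consistency

/-- Theorem 12: L-risk consistency of kernel-based regression. Let `X ⊂ ℝ^d` be
compact, `L` an invariant convex loss of lower and upper order `p ≥ 1`, `H` the RKHS
of a universal (continuous, bounded) kernel on `X` with feature map `Φ`, and let
`(λ_n)` satisfy `λ_n → 0` and `λ_n^{p*} n → ∞` with `p* = max{2p, p²}`. Then for every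
distribution `P` with `|P|_p < ∞` and every `ε > 0`, the probability (under `n`-fold
i.i.d. sampling from `P`) that the empirical regularized minimizer `f_{D,λ_n}` has
`L`-risk at most `R*_{L,P} + ε` tends to `1`. -/
theorem kbr_risk_consistency
    {d : ℕ} (X : Set (EuclideanSpace ℝ (Fin d)))
    (hXne : X.Nonempty) (hXcomp : IsCompact X)
    (Y : Set ℝ) (hYne : Y.Nonempty) (hYclosed : IsClosed Y)
    (L : ℝ → ℝ → ℝ)
    (hLmeas : Measurable fun q : ℝ × ℝ => L q.1 q.2)
    (l : ℝ → ℝ) (hl0 : l 0 = 0) (hlnonneg : ∀ r : ℝ, 0 ≤ l r)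
    (hinv : ∀ y ∈ Y, ∀ t : ℝ, L y t = l (y - t))
    (hconv : ConvexOn ℝ Set.univ l)
    (p : ℝ) (hp : 1 ≤ p)
    (hupper : ∃ c > (0 : ℝ), ∀ r : ℝ, l r ≤ c * (|r| ^ p + 1))
    (hlower : ∃ c > (0 : ℝ), ∀ r : ℝ, c * (|r| ^ p - 1) ≤ l r)
    {H : Type*} [NormedAddCommGroup H] [InnerProductSpace ℝ H] [CompleteSpace H]
    [SecondCountableTopology H]
    (Φ : X → H) (hΦcont : Continuous Φ)
    (huniversal : ∀ g : C(X, ℝ), ∀ δ > (0 : ℝ), ∃ f : H, ∀ x : X, |⟪f, Φ x⟫ - g x| < δ)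
    (lam : ℕ → ℝ) (hlampos : ∀ n, 0 < lam n)
    (hlam0 : Tendsto lam atTop (nhds 0))
    (hlamn : Tendsto (fun n : ℕ => lam n ^ max (2 * p) (p ^ 2) * n) atTop atTop)
    (P : Measure (X × ℝ)) [IsProbabilityMeasure P]
    (hPsupp : ∀ᵐ z ∂P, z.2 ∈ Y)
    (hPp : Integrable (fun z : X × ℝ => |z.2| ^ p) P)
    (ε : ℝ) (hε : 0 < ε) :
    Tendsto
      (fun n : ℕ =>
        (Measure.pi fun _ : Fin n => P)
          {D : Fin n → X × ℝ |
            ∀ fD : H,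
              (∀ f : H,
                (1 / n : ℝ) * (∑ i, L (D i).2 ⟪fD, Φ (D i).1⟫) + lam n * ‖fD‖ ^ 2 ≤
                  (1 / n : ℝ) * (∑ i, L (D i).2 ⟪f, Φ (D i).1⟫) + lam n * ‖f‖ ^ 2) →
              (∫⁻ z, ENNReal.ofReal (L z.2 ⟪fD, Φ z.1⟫) ∂P) ≤
                (⨅ (f : X → ℝ) (_ : Measurable f),
                    ∫⁻ z, ENNReal.ofReal (L z.2 (f z.1)) ∂P) + ENNReal.ofReal ε})
      atTop (nhds 1) := by
  have : CompactSpace X := isCompact_iff_compactSpace.1 hXcomp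
  obtain ⟨C, hC, hLip⟩ := exists_abs_sub_le_of_convex_of_growth hlnonneg hconv hp hupper
  obtain ⟨κ, hκ1, hκ⟩ : ∃ κ : ℝ, 1 ≤ κ ∧ ∀ x, ‖Φ x‖ ≤ κ := by
    obtain ⟨κ, hκ⟩ := (isCompact_range hΦcont).isBounded.exists_norm_le
    exact ⟨max 1 κ, le_max_left _ _, fun x => (hκ _ (mem_range_self x)).trans (le_max_right _ _)⟩
  have hLl : ∀ f : X → ℝ, ∫⁻ z, ENNReal.ofReal (L z.2 (f z.1)) ∂P =
      ∫⁻ z, ENNReal.ofReal (l (z.2 - f z.1)) ∂P := fun f =>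
    lintegral_congr_ae (hPsupp.mono fun z hz => by simp only [hinv z.2 hz])
  simp only [fun f : H => hLl fun x => ⟪f, Φ x⟫, hLl]
  set R : ℝ≥0∞ := ⨅ (f : X → ℝ) (_ : Measurable f),
    ∫⁻ z, ENNReal.ofReal (l (z.2 - f z.1)) ∂P
  have hRf : ∀ f : X → ℝ, Measurable f → R ≤ ∫⁻ z, ENNReal.ofReal (l (z.2 - f z.1)) ∂P :=
    fun f hf => iInf₂_le f hf
  have hfin := lintegral_ofReal_loss_ne_top hPp hupper
  have hR : R ≠ ∞ := by
    have h := hRf (fun _ => 0) measurable_const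
    simp only [sub_zero] at h
    exact ne_top_of_le_ne_top hfin h
  have hRle : ∀ h : H, R ≤ risk l Φ P h := fun h =>
    hRf (fun x => ⟪h, Φ x⟫) (continuous_const.inner hΦcont).measurable
  have hRapprox : ∀ δ > (0 : ℝ), ∃ h : H, risk l Φ P h ≤ R + ENNReal.ofReal δ := by
    intro δ hδ
    have hlt : R < R + ENNReal.ofReal (δ / 2) := ENNReal.lt_add_right hR (by simpa using hδ)
    obtain ⟨f, hfR⟩ := iInf_lt_iff.1 hlt
    obtain ⟨hf, hfR⟩ := iInf_lt_iff.1 hfR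
    obtain ⟨h, hh⟩ := exists_risk_le_of_universal hlnonneg hconv hp hC hLip hPp hfin huniversal hf
      hfR.ne_top (half_pos hδ)
    refine ⟨h, hh.trans ((add_le_add_left hfR.le _).trans (le_of_eq ?_))⟩
    rw [add_assoc, ← ENNReal.ofReal_add (by positivity) (by positivity), add_halves]
  have hfin0 : risk l Φ P 0 ≠ ∞ := by simpa [risk] using hfin
  rw [ENNReal.tendsto_nhds ENNReal.one_ne_top]
  intro η hη
  obtain ⟨η', hη', hηη'⟩ : ∃ η' : ℝ, 0 < η' ∧ ENNReal.ofReal η' ≤ η := by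
    obtain ⟨q, hq0, hq⟩ := ENNReal.lt_iff_exists_nnreal_btwn.1 hη
    exact ⟨q, by simpa using hq0, by simpa using hq.le⟩
  filter_upwards [eventually_measure_lt_risk_minimizer_le hlnonneg hconv hp hC hLip hΦcont hκ1 hκ
    hlampos hlam0 hlamn P hPp hfin0 hR hRle hRapprox hε hη'] with n hn
  refine ⟨?_, prob_le_one.trans le_self_add⟩
  have hsupp : ∀ᵐ D ∂(Measure.pi fun _ : Fin n => P), ∀ i, (D i).2 ∈ Y :=
    eventually_all.2 fun i =>
      (Measure.tendsto_eval_ae_ae (μ := fun _ : Fin n => P)).eventually hPsupp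
  rw [tsub_le_iff_right, ← measure_univ (μ := Measure.pi fun _ : Fin n => P)]
  refine le_trans ?_ (add_le_add_right (hn.trans hηη') _)
  refine le_trans (measure_mono_ae ?_) (measure_union_le _ _)
  filter_upwards [hsupp] with D hD _
  have hsum : ∀ f : H, (1 / n : ℝ) * ∑ i, L (D i).2 ⟪f, Φ (D i).1⟫ = empRisk l Φ D f := fun f => by
    simp only [empRisk, hinv _ (hD _)]
  refine (mem_union _ _ _).2 (or_iff_not_imp_left.2 fun hbad => ?_)
  simp only [mem_ofPred_eq, hsum, not_forall, not_le] at hbad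
  obtain ⟨f, hf, hfR⟩ := hbad
  exact ⟨f, hf, hfR⟩
end

section
/- Let H be the RKHS of a bounded continuous kernel k on X with canonical feature map Φ: X → H, let L: Y × ℝ → [0,∞) be a convex loss function of strong type (a, p), let λ > 0, and let P be a probability distribution on X × Y with |P|_a < ∞, where X ⊂ ℝ^d and Y ⊂ ℝ are closed. Then for every z = (x,y) ∈ X × Y the influence function of T(P) := f_{P,λ}, i.e., the limit IF(z; T, P) = lim_{ε↓0} ε^{−1}(f_{(1−ε)P+εΔ_z, λ} − f_{P,λ}) in H, exists and equals S^{−1}(E_P[L'(Y, f_{P,λ}(X)) Φ(X)]) − L'(y, f_{P,λ}(x))·S^{−1}Φ(x), where S: H → H is the invertible bounded linear operator S = 2λ·id_H + E_P[L''(Y, f_{P,λ}(X)) ⟨Φ(X), ·⟩ Φ(X)]. -/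
open MeasureTheory Filter Set Topology
open scoped RealInnerProductSpace ENNReal

/-- A loss is of Nemitski type for `μ` when its superpositions with measurable functions are
measurable and, on bounded ranges of the second argument, it is dominated by an integrable
function. -/
structure IsNemitski {Ω : Type*} [MeasurableSpace Ω] (μ : Measure Ω) (l : Ω → ℝ → ℝ) :
    Prop where
  aemeasurable : ∀ g : Ω → ℝ, Measurable g → AEMeasurable (fun ω => l ω (g ω)) μ
  exists_bound : ∀ R : ℝ, ∃ B : Ω → ℝ, Integrable B μ ∧
    ∀ᵐ ω ∂μ, ∀ t, |t| ≤ R → |l ω t| ≤ B ω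

section Nemitski

variable {Ω : Type*} [MeasurableSpace Ω] {μ : Measure Ω} {l l' l'' : Ω → ℝ → ℝ}

theorem aemeasurable_comp_of_hasDerivAt
    (hl : ∀ g : Ω → ℝ, Measurable g → AEMeasurable (fun ω => l ω (g ω)) μ)
    (hd : ∀ᵐ ω ∂μ, ∀ t, HasDerivAt (l ω) (l' ω t) t) (g : Ω → ℝ) (hg : Measurable g) :
    AEMeasurable (fun ω => l' ω (g ω)) μ := by
  refine aemeasurable_of_tendsto_metrizable_ae (𝓝[>] (0 : ℝ))
    (f := fun h ω => h⁻¹ • (l ω (g ω + h) - l ω (g ω))) (fun h => ?_) ?_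
  · exact ((hl _ (hg.add_const h)).sub (hl _ hg)).const_smul h⁻¹
  · filter_upwards [hd] with ω hω
    exact (hω (g ω)).tendsto_slope_zero_right

theorem isNemitski_of_growth [IsFiniteMeasure μ]
    (hl : ∀ g : Ω → ℝ, Measurable g → AEMeasurable (fun ω => l ω (g ω)) μ)
    {b : Ω → ℝ} (hb : Integrable b μ) {c p : ℝ} (hc : 0 < c) (hp : 0 ≤ p)
    (h : ∀ᵐ ω ∂μ, ∀ t, |l ω t| ≤ c * (b ω + |t| ^ p + 1)) : IsNemitski μ l := by
  refine ⟨hl, fun R => ⟨fun ω => c * (b ω + |R| ^ p + 1), ?_, ?_⟩⟩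
  · exact ((hb.add (integrable_const _)).add (integrable_const _)).const_mul c
  · filter_upwards [h] with ω hω t ht
    refine (hω t).trans ?_
    have : |t| ^ p ≤ |R| ^ p :=
      Real.rpow_le_rpow (abs_nonneg t) (ht.trans (le_abs_self R)) hp
    gcongr

theorem IsNemitski.integrable_comp (hl : IsNemitski μ l) {g : Ω → ℝ} (hg : Measurable g) {R : ℝ}
    (hR : ∀ ω, |g ω| ≤ R) : Integrable (fun ω => l ω (g ω)) μ := by
  obtain ⟨B, hB, hlB⟩ := hl.exists_bound R
  refine hB.mono' (hl.aemeasurable g hg).aestronglyMeasurable ?_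
  filter_upwards [hlB] with ω hω
  exact hω _ (hR ω)

variable {H : Type*} [NormedAddCommGroup H] [InnerProductSpace ℝ H]
  {Ψ : Ω → H} {κ : ℝ}

theorem measurable_inner_feature (hΨ : StronglyMeasurable Ψ) (f : H) :
    Measurable fun ω => ⟪f, Ψ ω⟫ :=
  (stronglyMeasurable_const.inner hΨ).measurable

theorem abs_inner_feature_le {ι : Type*} {Ψ : ι → H} (hκ : ∀ i, ‖Ψ i‖ ≤ κ) (f : H) (ω : ι) :
    |⟪f, Ψ ω⟫| ≤ ‖f‖ * κ :=
  (abs_real_inner_le_norm _ _).trans (by gcongr; exact hκ ω)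

theorem IsNemitski.integrable_comp_inner (hl : IsNemitski μ l) (hΨ : StronglyMeasurable Ψ)
    (hκ : ∀ ω, ‖Ψ ω‖ ≤ κ) (f : H) : Integrable (fun ω => l ω ⟪f, Ψ ω⟫) μ :=
  hl.integrable_comp (measurable_inner_feature hΨ f) (abs_inner_feature_le hκ f)

theorem IsNemitski.integrable_smul_feature (hl : IsNemitski μ l) (hΨ : StronglyMeasurable Ψ)
    (hκ : ∀ ω, ‖Ψ ω‖ ≤ κ) (f : H) : Integrable (fun ω => l ω ⟪f, Ψ ω⟫ • Ψ ω) μ :=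
  (hl.integrable_comp_inner hΨ hκ f).smul_bdd κ hΨ.aestronglyMeasurable (.of_forall hκ)

theorem IsNemitski.integrable_mul_inner_smul_feature (hl : IsNemitski μ l)
    (hΨ : StronglyMeasurable Ψ) (hκ : ∀ ω, ‖Ψ ω‖ ≤ κ) (f g : H) :
    Integrable (fun ω => (l ω ⟪f, Ψ ω⟫ * ⟪Ψ ω, g⟫) • Ψ ω) μ := by
  refine Integrable.smul_bdd ?_ κ hΨ.aestronglyMeasurable (.of_forall hκ)
  refine Integrable.mul_bdd (c := ‖g‖ * κ) (hl.integrable_comp_inner hΨ hκ f) ?_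
    (.of_forall fun ω => ?_)
  · exact (hΨ.inner stronglyMeasurable_const).aestronglyMeasurable
  · rw [real_inner_comm]
    exact abs_inner_feature_le hκ g ω

/-- The Euler equation of a regularized risk minimizer. -/
theorem two_smul_add_integral_eq_zero [CompleteSpace H] (hl : IsNemitski μ l)
    (hl' : IsNemitski μ l') (hd : ∀ᵐ ω ∂μ, ∀ t, HasDerivAt (l ω) (l' ω t) t)
    (hΨ : StronglyMeasurable Ψ) (hκ : ∀ ω, ‖Ψ ω‖ ≤ κ) {lam : ℝ} {f : H}
    (hf : ∀ g : H, (∫ ω, l ω ⟪f, Ψ ω⟫ ∂μ) + lam * ‖f‖ ^ 2 ≤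
      (∫ ω, l ω ⟪g, Ψ ω⟫ ∂μ) + lam * ‖g‖ ^ 2) :
    (2 * lam) • f + ∫ ω, l' ω ⟪f, Ψ ω⟫ • Ψ ω ∂μ = 0 := by
  refine ext_inner_left ℝ fun g => ?_
  rw [inner_zero_right, inner_add_right, inner_smul_right,
    ← integral_inner (hl'.integrable_smul_feature hΨ hκ f)]
  simp_rw [inner_smul_right]
  have hline : ∀ (s : ℝ) ω, ⟪f + s • g, Ψ ω⟫ = ⟪f, Ψ ω⟫ + s * ⟪g, Ψ ω⟫ := fun s ω => by
    rw [inner_add_left, real_inner_smul_left]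
  obtain ⟨B, hB, hlB⟩ := hl'.exists_bound ((‖f‖ + ‖g‖) * κ)
  have hrisk : HasDerivAt (fun s : ℝ => ∫ ω, l ω ⟪f + s • g, Ψ ω⟫ ∂μ)
      (∫ ω, l' ω ⟪f, Ψ ω⟫ * ⟪g, Ψ ω⟫ ∂μ) 0 := by
    have := (hasDerivAt_integral_of_dominated_loc_of_deriv_le (μ := μ) (x₀ := (0 : ℝ))
      (F := fun s ω => l ω ⟪f + s • g, Ψ ω⟫)
      (F' := fun s ω => l' ω ⟪f + s • g, Ψ ω⟫ * ⟪g, Ψ ω⟫)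
      (bound := fun ω => B ω * (‖g‖ * κ))
      (Metric.closedBall_mem_nhds 0 one_pos) ?_ ?_ ?_ ?_ ?_ ?_).2
    · simpa using this
    · exact .of_forall fun s => (hl.integrable_comp_inner hΨ hκ _).aestronglyMeasurable
    · exact hl.integrable_comp_inner hΨ hκ _
    · exact (hl'.integrable_comp_inner hΨ hκ _).aestronglyMeasurable.mul
        (measurable_inner_feature hΨ g).aestronglyMeasurable
    · filter_upwards [hlB] with ω hω s hs
      have hs : |s| ≤ 1 := by simpa using hs
      have hκ0 : 0 ≤ κ := (norm_nonneg _).trans (hκ ω)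
      rw [Real.norm_eq_abs, abs_mul]
      have h1 : |⟪f + s • g, Ψ ω⟫| ≤ (‖f‖ + ‖g‖) * κ := by
        refine (abs_inner_feature_le hκ _ ω).trans ?_
        gcongr
        refine (norm_add_le _ _).trans ?_
        rw [norm_smul, Real.norm_eq_abs]
        nlinarith [norm_nonneg g]
      have h2 := hω _ h1
      have h3 := abs_inner_feature_le hκ g ω
      exact mul_le_mul h2 h3 (abs_nonneg _) ((abs_nonneg _).trans h2)
    · exact hB.mul_const _
    · filter_upwards [hd] with ω hω s _
      have h1 : HasDerivAt (fun s : ℝ => ⟪f + s • g, Ψ ω⟫) ⟪g, Ψ ω⟫ s := by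
        simp_rw [hline]
        simpa using ((hasDerivAt_id s).mul_const ⟪g, Ψ ω⟫).const_add ⟪f, Ψ ω⟫
      exact (hω _).comp s h1
  have hnorm : HasDerivAt (fun s : ℝ => ‖f + s • g‖ ^ 2) (2 * ⟪f, g⟫) 0 := by
    have h1 : HasDerivAt (fun s : ℝ => f + s • g) g 0 := by
      simpa using ((hasDerivAt_id (0 : ℝ)).smul_const g).const_add f
    simpa using h1.norm_sq
  have hmin : IsLocalMin
      (fun s : ℝ => (∫ ω, l ω ⟪f + s • g, Ψ ω⟫ ∂μ) + lam * ‖f + s • g‖ ^ 2) 0 :=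
    .of_forall fun s => by simpa using hf (f + s • g)
  have := hmin.hasDerivAt_eq_zero (hrisk.add (hnorm.const_mul lam))
  rw [real_inner_comm f g]
  linarith

theorem hasDerivAt_tendsto_remainder {φ : ℝ → ℝ} {φ' t M : ℝ} (hφ : HasDerivAt φ φ' t)
    {s : ℝ → ℝ} (hs : ∀ᶠ ε in 𝓝[>] (0 : ℝ), |s ε| ≤ M) :
    Tendsto (fun ε => ε⁻¹ * (φ (t + ε * s ε) - φ t) - φ' * s ε) (𝓝[>] 0) (𝓝 0) := by
  have hO : (fun ε => ε * s ε) =O[𝓝[>] (0 : ℝ)] (fun ε : ℝ => ε) := by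
    refine Asymptotics.IsBigO.of_bound M ?_
    filter_upwards [hs] with ε hε
    rw [norm_mul, mul_comm]
    exact mul_le_mul_of_nonneg_right hε (norm_nonneg _)
  have hid : Tendsto (fun ε : ℝ => ε) (𝓝[>] 0) (𝓝 0) := tendsto_nhdsWithin_of_tendsto_nhds
    tendsto_id
  have ho := ((hasDerivAt_iff_isLittleO_nhds_zero.1 hφ).comp_tendsto
    (hO.trans_tendsto hid)).trans_isBigO hO
  refine ho.tendsto_div_nhds_zero.congr' ?_
  filter_upwards [self_mem_nhdsWithin] with ε (hε : 0 < ε)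
  simp only [Function.comp_apply, smul_eq_mul]
  field_simp

/-- The gradient of the risk is differentiable along bounded, not necessarily convergent,
directions. -/
theorem tendsto_integral_remainder (hl' : IsNemitski μ l') (hl'' : IsNemitski μ l'')
    (hd : ∀ᵐ ω ∂μ, ∀ t, HasDerivAt (l' ω) (l'' ω t) t)
    (hΨ : StronglyMeasurable Ψ) (hκ : ∀ ω, ‖Ψ ω‖ ≤ κ) (f : H) {u : ℝ → H} {M : ℝ}
    (hu : ∀ᶠ ε in 𝓝[>] (0 : ℝ), ‖u ε‖ ≤ M) :
    Tendsto (fun ε : ℝ => ∫ ω, (ε⁻¹ * (l' ω ⟪f + ε • u ε, Ψ ω⟫ - l' ω ⟪f, Ψ ω⟫) -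
      l'' ω ⟪f, Ψ ω⟫ * ⟪Ψ ω, u ε⟫) • Ψ ω ∂μ) (𝓝[>] 0) (𝓝 0) := by
  obtain ⟨B, hB, hlB⟩ := hl''.exists_bound ((‖f‖ + M) * κ)
  have hline : ∀ (ε : ℝ) ω, ⟪f + ε • u ε, Ψ ω⟫ = ⟪f, Ψ ω⟫ + ε * ⟪u ε, Ψ ω⟫ := fun ε ω => by
    rw [inner_add_left, real_inner_smul_left]
  rw [← integral_zero (α := Ω) (G := H) (μ := μ)]
  refine tendsto_integral_filter_of_dominated_convergence
    (fun ω => (B ω * (M * κ) + B ω * (M * κ)) * κ) ?_ ?_ ?_ ?_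
  · refine .of_forall fun ε => AEStronglyMeasurable.smul ?_ hΨ.aestronglyMeasurable
    refine (((hl'.integrable_comp_inner hΨ hκ _).sub
      (hl'.integrable_comp_inner hΨ hκ _)).aestronglyMeasurable.const_mul _).sub ?_
    exact (hl''.integrable_comp_inner hΨ hκ _).aestronglyMeasurable.mul
      (hΨ.inner stronglyMeasurable_const).aestronglyMeasurable
  · filter_upwards [hu, Ioo_mem_nhdsGT (zero_lt_one (α := ℝ))] with ε hε hε1
    filter_upwards [hd, hlB] with ω hdω hω
    have hM : 0 ≤ M := (norm_nonneg _).trans hε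
    have hκ0 : 0 ≤ κ := (norm_nonneg _).trans (hκ ω)
    have hf := abs_inner_feature_le hκ f ω
    have huω : |⟪u ε, Ψ ω⟫| ≤ M * κ :=
      (abs_inner_feature_le hκ (u ε) ω).trans (by gcongr)
    have hf' : |⟪f, Ψ ω⟫| ≤ (‖f‖ + M) * κ := hf.trans (by gcongr; linarith)
    have hB0 : 0 ≤ B ω := (abs_nonneg _).trans (hω _ hf')
    have hfu : |⟪f, Ψ ω⟫ + ε * ⟪u ε, Ψ ω⟫| ≤ (‖f‖ + M) * κ := by
      refine (abs_add_le _ _).trans ?_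
      rw [abs_mul, abs_of_pos hε1.1]
      nlinarith [hε1.2, hε1.1, abs_nonneg ⟪u ε, Ψ ω⟫]
    have hmv := Convex.norm_image_sub_le_of_norm_hasDerivWithin_le
      (fun t _ => (hdω t).hasDerivWithinAt) (fun t ht => hω t (abs_le.2 ht))
      (convex_Icc (-((‖f‖ + M) * κ)) ((‖f‖ + M) * κ)) (abs_le.1 hf') (abs_le.1 hfu)
    rw [hline, norm_smul, real_inner_comm (u ε)]
    have h1 : ‖ε⁻¹ * (l' ω (⟪f, Ψ ω⟫ + ε * ⟪u ε, Ψ ω⟫) - l' ω ⟪f, Ψ ω⟫)‖ ≤ B ω * (M * κ) := by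
      rw [norm_mul, norm_inv, Real.norm_of_nonneg hε1.1.le, inv_mul_le_iff₀ hε1.1]
      refine hmv.trans ?_
      rw [add_sub_cancel_left, norm_mul, Real.norm_of_nonneg hε1.1.le, Real.norm_eq_abs,
        mul_left_comm]
      have := hε1.1.le
      gcongr
    have h2 : ‖l'' ω ⟪f, Ψ ω⟫ * ⟪u ε, Ψ ω⟫‖ ≤ B ω * (M * κ) := by
      rw [norm_mul]
      exact mul_le_mul (hω _ hf') huω (abs_nonneg _) hB0
    exact mul_le_mul ((norm_sub_le _ _).trans (add_le_add h1 h2)) (hκ ω) (norm_nonneg _)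
      (by positivity)
  · exact ((hB.mul_const _).add (hB.mul_const _)).mul_const _
  · filter_upwards [hd] with ω hω
    have hs : ∀ᶠ ε in 𝓝[>] (0 : ℝ), |⟪u ε, Ψ ω⟫| ≤ M * κ := by
      filter_upwards [hu] with ε hε
      have hκ0 : 0 ≤ κ := (norm_nonneg _).trans (hκ ω)
      exact (abs_inner_feature_le hκ (u ε) ω).trans (by gcongr)
    have := (hasDerivAt_tendsto_remainder (hω ⟪f, Ψ ω⟫) hs).smul_const (Ψ ω)
    rw [zero_smul] at this
    simpa only [hline, real_inner_comm] using this

/-- The covariance operator of the feature map, weighted by a loss at `f`, is bounded. -/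
theorem exists_integral_operator (hl'' : IsNemitski μ l'') (hΨ : StronglyMeasurable Ψ)
    (hκ : ∀ ω, ‖Ψ ω‖ ≤ κ) (f : H) :
    ∃ A : H →L[ℝ] H, ∀ g, A g = ∫ ω, (l'' ω ⟪f, Ψ ω⟫ * ⟪Ψ ω, g⟫) • Ψ ω ∂μ := by
  have hint := hl''.integrable_mul_inner_smul_feature hΨ hκ f
  refine ⟨LinearMap.mkContinuous
    { toFun := fun g => ∫ ω, (l'' ω ⟪f, Ψ ω⟫ * ⟪Ψ ω, g⟫) • Ψ ω ∂μ
      map_add' := fun g g' => ?_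
      map_smul' := fun r g => ?_ } (∫ ω, |l'' ω ⟪f, Ψ ω⟫| * κ * κ ∂μ) fun g => ?_, fun g => rfl⟩
  · rw [← integral_add (hint g) (hint g')]
    simp only [inner_add_right, mul_add, add_smul]
  · rw [RingHom.id_apply, ← integral_smul]
    simp only [inner_smul_right, smul_smul, mul_left_comm]
  · rw [← integral_mul_const]
    refine norm_integral_le_of_norm_le
      ((((hl''.integrable_comp_inner hΨ hκ f).abs.mul_const κ).mul_const κ).mul_const ‖g‖)
      (.of_forall fun ω => ?_)
    have hκ0 : 0 ≤ κ := (norm_nonneg _).trans (hκ ω)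
    have h := abs_inner_feature_le hκ g ω
    rw [norm_smul, norm_mul, real_inner_comm g, Real.norm_eq_abs, Real.norm_eq_abs]
    calc |l'' ω ⟪f, Ψ ω⟫| * |⟪g, Ψ ω⟫| * ‖Ψ ω‖
        ≤ |l'' ω ⟪f, Ψ ω⟫| * (‖g‖ * κ) * κ := by gcongr; exact hκ ω
      _ = |l'' ω ⟪f, Ψ ω⟫| * κ * κ * ‖g‖ := by ring

theorem exists_continuousLinearEquiv_hessian [CompleteSpace H] (hl'' : IsNemitski μ l'')
    (hpos : ∀ᵐ ω ∂μ, ∀ t, 0 ≤ l'' ω t) (hΨ : StronglyMeasurable Ψ)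
    (hκ : ∀ ω, ‖Ψ ω‖ ≤ κ) (f : H) {r : ℝ} (hr : 0 < r) :
    ∃ S : H ≃L[ℝ] H, ∀ g, S g = r • g + ∫ ω, (l'' ω ⟪f, Ψ ω⟫ * ⟪Ψ ω, g⟫) • Ψ ω ∂μ := by
  obtain ⟨A, hA⟩ := exists_integral_operator hl'' hΨ hκ f
  let B : H →L[ℝ] H →L[ℝ] ℝ := (innerSL ℝ).comp (r • ContinuousLinearMap.id ℝ H + A)
  have hB : ∀ v w, B v w = ⟪r • v + A v, w⟫ := fun v w => rfl
  have hcoer : IsCoercive B := by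
    refine ⟨r, hr, fun v => ?_⟩
    have hnn : 0 ≤ ⟪v, A v⟫ := by
      rw [hA, ← integral_inner (hl''.integrable_mul_inner_smul_feature hΨ hκ f v)]
      refine integral_nonneg_of_ae ?_
      filter_upwards [hpos] with ω hω
      rw [Pi.zero_apply, inner_smul_right, real_inner_comm v, mul_assoc]
      exact mul_nonneg (hω _) (mul_self_nonneg _)
    rw [hB, inner_add_left, real_inner_smul_left, real_inner_self_eq_norm_mul_norm,
      real_inner_comm]
    linarith
  refine ⟨hcoer.continuousLinearEquivOfBilin, fun g => ?_⟩
  refine ext_inner_right ℝ fun w => ?_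
  rw [IsCoercive.continuousLinearEquivOfBilin_apply, hB, hA]

theorem integral_sub_inner_nonneg [CompleteSpace H] (hl' : IsNemitski μ l')
    (hmono : ∀ᵐ ω ∂μ, Monotone (l' ω))
    (hΨ : StronglyMeasurable Ψ) (hκ : ∀ ω, ‖Ψ ω‖ ≤ κ) (f g : H) :
    0 ≤ ⟪g - f, (∫ ω, l' ω ⟪g, Ψ ω⟫ • Ψ ω ∂μ) - ∫ ω, l' ω ⟪f, Ψ ω⟫ • Ψ ω ∂μ⟫ := by
  have hf := hl'.integrable_smul_feature hΨ hκ f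
  have hg := hl'.integrable_smul_feature hΨ hκ g
  have hgf := integral_inner (𝕜 := ℝ) (hg.sub hf) (g - f)
  simp only [Pi.sub_apply] at hgf
  rw [← integral_sub hg hf, ← hgf]
  refine integral_nonneg_of_ae ?_
  filter_upwards [hmono] with ω hω
  rw [Pi.zero_apply, ← sub_smul, inner_smul_right, inner_sub_left]
  rcases le_total ⟪f, Ψ ω⟫ ⟪g, Ψ ω⟫ with h | h
  · exact mul_nonneg (sub_nonneg.2 (hω h)) (sub_nonneg.2 h)
  · exact mul_nonneg_of_nonpos_of_nonpos (sub_nonpos.2 (hω h)) (sub_nonpos.2 h)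

end Nemitski

theorem monotone_of_convexOn_of_hasDerivAt {φ φ' : ℝ → ℝ} (hφ : ConvexOn ℝ univ φ)
    (hd : ∀ t, HasDerivAt φ (φ' t) t) : Monotone φ' := by
  have h := hφ.monotoneOn_deriv fun t _ => (hd t).differentiableAt
  rwa [monotoneOn_univ, show deriv φ = φ' from funext fun t => (hd t).deriv] at h

/-- Theorem 15: existence of the influence function of `T(P) := f_{P,λ}` for a convex
loss of strong type `(a,p)`. For every `z = (x,y) ∈ X × Y` the limit
`IF(z;T,P) = lim_{ε ↓ 0} ε⁻¹ (f_{(1-ε)P + εΔ_z, λ} - f_{P,λ})` exists in `H` and equals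
`S⁻¹(E_P[L'(Y, f_{P,λ}(X)) Φ(X)]) - L'(y, f_{P,λ}(x)) S⁻¹ Φ(x)`, where
`S = 2λ id_H + E_P[L''(Y, f_{P,λ}(X)) ⟪Φ(X), ·⟫ Φ(X)]` is invertible. -/
theorem influence_function_of_kbr
    {d : ℕ} (X : Set (EuclideanSpace ℝ (Fin d))) (hXclosed : IsClosed X)
    (Y : Set ℝ) (hYne : Y.Nonempty) (hYclosed : IsClosed Y)
    {H : Type*} [NormedAddCommGroup H] [InnerProductSpace ℝ H] [CompleteSpace H]
    [SecondCountableTopology H]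
    (Φ : X → H) (hΦcont : Continuous Φ) (hΦmeas : StronglyMeasurable Φ)
    (kb : ℝ) (hkb : ∀ x : X, ‖Φ x‖ ≤ kb)
    (L L' L'' : ℝ → ℝ → ℝ)
    (hLmeas : Measurable fun q : ℝ × ℝ => L q.1 q.2)
    (hLnonneg : ∀ y ∈ Y, ∀ t : ℝ, 0 ≤ L y t)
    (hLconv : ∀ y ∈ Y, ConvexOn ℝ Set.univ (L y))
    (hL' : ∀ y ∈ Y, ∀ t : ℝ, HasDerivAt (L y) (L' y t) t)
    (hL'' : ∀ y ∈ Y, ∀ t : ℝ, HasDerivAt (L' y) (L'' y t) t)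
    (a : ℝ → ℝ) (hameas : Measurable a) (hanonneg : ∀ y ∈ Y, 0 ≤ a y)
    (p : ℝ) (hp : 0 ≤ p)
    (htypeL : ∃ c > (0 : ℝ), ∀ y ∈ Y, ∀ t : ℝ, L y t ≤ c * (a y + |t| ^ p + 1))
    (htypeL' : ∃ c > (0 : ℝ), ∀ y ∈ Y, ∀ t : ℝ, |L' y t| ≤ c * (a y + |t| ^ p + 1))
    (htypeL'' : ∃ c > (0 : ℝ), ∀ y ∈ Y, ∀ t : ℝ, |L'' y t| ≤ c * (a y + |t| ^ p + 1))
    (lam : ℝ) (hlam : 0 < lam)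
    (P : Measure (X × ℝ)) [IsProbabilityMeasure P]
    (hPsupp : ∀ᵐ z ∂P, z.2 ∈ Y)
    (hPa : Integrable (fun z : X × ℝ => a z.2) P)
    (fP : H)
    (hfP : ∀ f : H,
      (∫ z, L z.2 ⟪fP, Φ z.1⟫ ∂P) + lam * ‖fP‖ ^ 2 ≤
        (∫ z, L z.2 ⟪f, Φ z.1⟫ ∂P) + lam * ‖f‖ ^ 2)
    (x : X) (y : ℝ) (hy : y ∈ Y)
    (fQ : ℝ → H)
    (hfQ : ∀ ε ∈ Set.Ioo (0 : ℝ) 1, ∀ f : H,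
      (∫ z, L z.2 ⟪fQ ε, Φ z.1⟫
          ∂(ENNReal.ofReal (1 - ε) • P + ENNReal.ofReal ε • Measure.dirac (x, y))) +
          lam * ‖fQ ε‖ ^ 2 ≤
        (∫ z, L z.2 ⟪f, Φ z.1⟫
          ∂(ENNReal.ofReal (1 - ε) • P + ENNReal.ofReal ε • Measure.dirac (x, y))) +
          lam * ‖f‖ ^ 2) :
    ∃ S : H ≃L[ℝ] H,
      (∀ g : H,
        S g = (2 * lam) • g +
          ∫ z, (L'' z.2 ⟪fP, Φ z.1⟫ * ⟪Φ z.1, g⟫) • Φ z.1 ∂P) ∧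
      Tendsto (fun ε : ℝ => ε⁻¹ • (fQ ε - fP)) (nhdsWithin 0 (Set.Ioi 0))
        (nhds (S.symm (∫ z, L' z.2 ⟪fP, Φ z.1⟫ • Φ z.1 ∂P) -
          L' y ⟪fP, Φ x⟫ • S.symm (Φ x))) := by
  obtain ⟨cL, hcL, hcL_le⟩ := htypeL
  obtain ⟨c', hc', hc'_le⟩ := htypeL'
  obtain ⟨c'', hc'', hc''_le⟩ := htypeL''
  have hΨ : StronglyMeasurable fun z : X × ℝ => Φ z.1 := hΦmeas.comp_measurable measurable_fst
  have hκ : ∀ z : X × ℝ, ‖Φ z.1‖ ≤ kb := fun z => hkb z.1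
  have hmeas : ∀ (μ : Measure (X × ℝ)) (g : X × ℝ → ℝ), Measurable g →
      AEMeasurable (fun z => L z.2 (g z)) μ := fun μ g hg =>
    (hLmeas.comp (measurable_snd.prodMk hg)).aemeasurable
  have hY {q : ℝ → Prop} (hq : ∀ y ∈ Y, q y) {μ : Measure (X × ℝ)}
      (hμ : ∀ᵐ z ∂μ, z.2 ∈ Y) : ∀ᵐ z ∂μ, q z.2 := hμ.mono fun z hz => hq _ hz
  have hmono : ∀ y ∈ Y, Monotone (L' y) := fun y hy =>
    monotone_of_convexOn_of_hasDerivAt (hLconv y hy) (hL' y hy)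
  have hL''nn : ∀ y ∈ Y, ∀ t, 0 ≤ L'' y t := fun y hy t => by
    rw [← (hL'' y hy t).deriv]
    exact (hmono y hy).deriv_nonneg
  have hcL_abs : ∀ y ∈ Y, ∀ t, |L y t| ≤ cL * (a y + |t| ^ p + 1) := fun y hy t => by
    rw [abs_of_nonneg (hLnonneg y hy t)]
    exact hcL_le y hy t
  have hnemL {μ : Measure (X × ℝ)} [IsFiniteMeasure μ] (hμ : ∀ᵐ z ∂μ, z.2 ∈ Y)
      (hμa : Integrable (fun z : X × ℝ => a z.2) μ) : IsNemitski μ fun z => L z.2 :=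
    isNemitski_of_growth (hmeas μ) hμa hcL hp
      (hY hcL_abs hμ)
  have hnemL' {μ : Measure (X × ℝ)} [IsFiniteMeasure μ] (hμ : ∀ᵐ z ∂μ, z.2 ∈ Y)
      (hμa : Integrable (fun z : X × ℝ => a z.2) μ) : IsNemitski μ fun z => L' z.2 :=
    isNemitski_of_growth (aemeasurable_comp_of_hasDerivAt (hmeas μ) (hY hL' hμ)) hμa hc' hp
      (hY hc'_le hμ)
  have hnemL'' : IsNemitski P fun z => L'' z.2 :=
    isNemitski_of_growth (aemeasurable_comp_of_hasDerivAt (hnemL' hPsupp hPa).aemeasurable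
      (hY hL'' hPsupp)) hPa hc'' hp (hY hc''_le hPsupp)
  have hN' := hnemL' hPsupp hPa
  obtain ⟨S, hS⟩ := exists_continuousLinearEquiv_hessian hnemL'' (hY hL''nn hPsupp) hΨ hκ fP
    (mul_pos two_pos hlam)
  refine ⟨S, hS, ?_⟩
  set G : H → H := fun f => ∫ z, L' z.2 ⟪f, Φ z.1⟫ • Φ z.1 ∂P with hG
  have heulerP : (2 * lam) • fP + G fP = 0 :=
    two_smul_add_integral_eq_zero (hnemL hPsupp hPa) hN' (hY hL' hPsupp) hΨ hκ hfP
  have heulerQ : ∀ ε ∈ Ioo (0 : ℝ) 1, (2 * lam) • fQ ε + ((1 - ε) • G (fQ ε) +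
      ε • L' y ⟪fQ ε, Φ x⟫ • Φ x) = 0 := by
    intro ε hε
    have hsupp : ∀ᵐ z ∂(ENNReal.ofReal (1 - ε) • P + ENNReal.ofReal ε • Measure.dirac (x, y)),
        z.2 ∈ Y := by
      refine ae_add_measure_iff.2 ⟨Measure.ae_smul_measure hPsupp _,
        Measure.ae_smul_measure ?_ _⟩
      rw [ae_dirac_eq]
      exact hy
    have ha : Integrable (fun z : X × ℝ => a z.2)
        (ENNReal.ofReal (1 - ε) • P + ENNReal.ofReal ε • Measure.dirac (x, y)) :=
      (hPa.smul_measure ENNReal.ofReal_ne_top).add_measure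
        ((integrable_dirac enorm_lt_top).smul_measure ENNReal.ofReal_ne_top)
    have : IsFiniteMeasure (ENNReal.ofReal (1 - ε) • P +
        ENNReal.ofReal ε • Measure.dirac (x, y)) := by
      have := P.smul_finite (ENNReal.ofReal_ne_top (r := 1 - ε))
      have := (Measure.dirac (x, y)).smul_finite (ENNReal.ofReal_ne_top (r := ε))
      infer_instance
    have h := two_smul_add_integral_eq_zero (hnemL hsupp ha) (hnemL' hsupp ha) (hY hL' hsupp)
      hΨ hκ (hfQ ε hε)
    rwa [integral_add_measure
      ((hN'.integrable_smul_feature hΨ hκ _).smul_measure ENNReal.ofReal_ne_top)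
      ((integrable_dirac enorm_lt_top).smul_measure ENNReal.ofReal_ne_top),
      integral_smul_measure, integral_smul_measure, integral_dirac,
      ENNReal.toReal_ofReal hε.1.le, ENNReal.toReal_ofReal (sub_nonneg.2 hε.2.le)] at h
  set w : H := G fP - L' y ⟪fP, Φ x⟫ • Φ x with hw
  set u : ℝ → H := fun ε => ε⁻¹ • (fQ ε - fP) with hu
  have hfQu : ∀ ε ∈ Ioo (0 : ℝ) 1, fQ ε = fP + ε • u ε := fun ε hε => by
    rw [hu, smul_inv_smul₀ hε.1.ne', add_sub_cancel]
  have hIoo : Ioo (0 : ℝ) 1 ∈ 𝓝[>] (0 : ℝ) := Ioo_mem_nhdsGT zero_lt_one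
  have hubound : ∀ᶠ ε in 𝓝[>] (0 : ℝ), ‖u ε‖ ≤ ‖w‖ / (2 * lam) := by
    filter_upwards [hIoo] with ε hε
    have hmonoG : 0 ≤ ⟪fQ ε - fP, G (fQ ε) - G fP⟫ :=
      integral_sub_inner_nonneg hN' (hY hmono hPsupp) hΨ hκ fP (fQ ε)
    have hmonox : 0 ≤ (L' y ⟪fQ ε, Φ x⟫ - L' y ⟪fP, Φ x⟫) * ⟪fQ ε - fP, Φ x⟫ := by
      rw [inner_sub_left]
      rcases le_total ⟪fP, Φ x⟫ ⟪fQ ε, Φ x⟫ with h | h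
      · exact mul_nonneg (sub_nonneg.2 (hmono y hy h)) (sub_nonneg.2 h)
      · exact mul_nonneg_of_nonpos_of_nonpos (sub_nonpos.2 (hmono y hy h)) (sub_nonpos.2 h)
    have hsplit : (2 * lam) • (fQ ε - fP) = ε • w - ((1 - ε) • (G (fQ ε) - G fP) +
        ε • (L' y ⟪fQ ε, Φ x⟫ - L' y ⟪fP, Φ x⟫) • Φ x) := by
      rw [hw]
      linear_combination (norm := module) heulerQ ε hε - heulerP
    have hinner := congrArg (fun v => ⟪fQ ε - fP, v⟫) hsplit
    simp only [inner_sub_right (𝕜 := ℝ) (fQ ε - fP) (ε • w), inner_add_right, inner_smul_right,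
      real_inner_self_eq_norm_mul_norm] at hinner
    have hCS := real_inner_le_norm (fQ ε - fP) w
    have hle : 2 * lam * (‖fQ ε - fP‖ * ‖fQ ε - fP‖) ≤ ε * (‖fQ ε - fP‖ * ‖w‖) := by
      have h1 := mul_nonneg (sub_nonneg.2 hε.2.le) hmonoG
      have h2 := mul_nonneg hε.1.le hmonox
      have h3 := mul_le_mul_of_nonneg_left hCS hε.1.le
      linarith
    rw [hu, norm_smul, norm_inv, Real.norm_of_nonneg hε.1.le, inv_mul_le_iff₀ hε.1,
      mul_div_assoc', le_div_iff₀ (mul_pos two_pos hlam)]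
    rcases (norm_nonneg (fQ ε - fP)).eq_or_lt with h0 | h0
    · rw [← h0, zero_mul]
      exact mul_nonneg hε.1.le (norm_nonneg _)
    · refine le_of_mul_le_mul_left ?_ h0
      linarith
  obtain ⟨A, hA⟩ := exists_integral_operator hnemL'' hΨ hκ fP
  have hrem := tendsto_integral_remainder hN' hnemL'' (hY hL'' hPsupp) hΨ hκ fP hubound
  set r : ℝ → H := fun ε => ∫ z, (ε⁻¹ * (L' z.2 ⟪fP + ε • u ε, Φ z.1⟫ - L' z.2 ⟪fP, Φ z.1⟫) -
    L'' z.2 ⟪fP, Φ z.1⟫ * ⟪Φ z.1, u ε⟫) • Φ z.1 ∂P with hr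
  have hGdiff : ∀ ε ∈ Ioo (0 : ℝ) 1, G (fQ ε) - G fP = ε • (r ε + A (u ε)) := by
    intro ε hε
    have h1 := hN'.integrable_smul_feature hΨ hκ (fP + ε • u ε)
    have h2 := hN'.integrable_smul_feature hΨ hκ fP
    have h3 := hnemL''.integrable_mul_inner_smul_feature hΨ hκ fP (u ε)
    have : r ε = ε⁻¹ • (G (fP + ε • u ε) - G fP) - A (u ε) := by
      rw [hA, hG, ← integral_sub h1 h2, ← integral_smul]
      refine Eq.trans ?_ (integral_sub ((h1.sub h2).smul ε⁻¹) h3)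
      simp only [hr, sub_smul, mul_smul]
    rw [this, ← hfQu ε hε, sub_add_cancel, smul_inv_smul₀ hε.1.ne']
  have hid : Tendsto (fun ε : ℝ => ε) (𝓝[>] 0) (𝓝 0) :=
    tendsto_nhdsWithin_of_tendsto_nhds tendsto_id
  have hzero_smul {v : ℝ → H} {M : ℝ} (hv : ∀ᶠ ε in 𝓝[>] (0 : ℝ), ‖v ε‖ ≤ M) :
      Tendsto (fun ε => ε • v ε) (𝓝[>] 0) (𝓝 0) :=
    hid.zero_smul_isBoundedUnder_le ⟨M, eventually_map.2 hv⟩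
  have hfQ_tendsto : Tendsto fQ (𝓝[>] 0) (𝓝 fP) := by
    have := (hzero_smul hubound).const_add fP
    rw [add_zero] at this
    refine this.congr' ?_
    filter_upwards [hIoo] with ε hε
    exact (hfQu ε hε).symm
  have hA_tendsto : Tendsto (fun ε => ε • A (u ε)) (𝓝[>] 0) (𝓝 0) := by
    refine hzero_smul (M := ‖A‖ * (‖w‖ / (2 * lam))) ?_
    filter_upwards [hubound] with ε hε
    exact A.le_opNorm_of_le hε
  have hx_tendsto : Tendsto (fun ε => (L' y ⟪fQ ε, Φ x⟫ - L' y ⟪fP, Φ x⟫) • Φ x)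
      (𝓝[>] 0) (𝓝 0) := by
    have h := ((hL'' y hy ⟪fP, Φ x⟫).continuousAt.tendsto.comp
      (hfQ_tendsto.inner tendsto_const_nhds)).sub_const (L' y ⟪fP, Φ x⟫)
    rw [sub_self] at h
    simpa using h.smul_const (Φ x)
  have hSu : Tendsto (fun ε => S (u ε)) (𝓝[>] 0) (𝓝 w) := by
    have h := (((hid.const_sub 1).smul hrem).const_sub w).add (hA_tendsto.sub hx_tendsto)
    simp only [smul_zero, sub_zero, add_zero] at h
    refine h.congr' ?_
    filter_upwards [hIoo] with ε hε
    have hdiff := hGdiff ε hε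
    refine smul_right_injective H hε.1.ne' ?_
    have hQ := heulerQ ε hε
    have hfu : ε • u ε = fQ ε - fP := smul_inv_smul₀ hε.1.ne' _
    simp only [hS, ← hA]
    rw [hw]
    linear_combination (norm := module) heulerP - hQ + (1 - ε) • hdiff - (2 * lam) • hfu
  have hlim := (S.symm.continuous.tendsto w).comp hSu
  rw [hw, map_sub, map_smul] at hlim
  simpa only [Function.comp_def, ContinuousLinearEquiv.symm_apply_apply] using hlim
end

section
/- Let H be the RKHS of a bounded continuous kernel on the closed sets X ⊂ ℝ^d, Y ⊂ ℝ, with canonical feature map Φ: X → H, let L: Y × ℝ → [0,∞) be a convex loss function of strong type (a, p), let λ > 0, and let P be a probability distribution on X × Y with |P|_a < ∞. Then the linear operator A: H → H defined by A g := E_P[L''(Y, f_{P,λ}(X)) ⟨g, Φ(X)⟩ Φ(X)] is a compact operator, and the operator S := 2λ·id_H + A is an invertible bounded linear operator on H. -/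
open MeasureTheory Filter Set Topology
open scoped RealInnerProductSpace ENNReal

/-- The partial derivative in the second variable of a jointly measurable function is jointly
measurable. -/
theorem measurable_uncurry_of_hasDerivAt {α : Type*} [MeasurableSpace α] {F F' : α → ℝ → ℝ}
    (hF : Measurable fun q : α × ℝ => F q.1 q.2)
    (hF' : ∀ y t, HasDerivAt (F y) (F' y t) t) :
    Measurable fun q : α × ℝ => F' q.1 q.2 := by
  have hu : Tendsto (fun n : ℕ => 1 / ((n : ℝ) + 1)) atTop (𝓝[≠] 0) :=
    tendsto_nhdsWithin_iff.2 ⟨tendsto_one_div_add_atTop_nhds_zero_nat,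
      Eventually.of_forall fun n => (Nat.one_div_pos_of_nat (n := n)).ne'⟩
  refine measurable_of_tendsto_metrizable
    (f := fun (n : ℕ) (q : α × ℝ) =>
      (1 / ((n : ℝ) + 1))⁻¹ • (F q.1 (q.2 + 1 / ((n : ℝ) + 1)) - F q.1 q.2)) (fun n => ?_) ?_
  · have hshift : Measurable fun q : α × ℝ => F q.1 (q.2 + 1 / ((n : ℝ) + 1)) :=
      hF.comp (measurable_fst.prodMk (measurable_snd.add_const _))
    exact (hshift.sub hF).const_mul (1 / ((n : ℝ) + 1))⁻¹
  · exact tendsto_pi_nhds.2 fun q => (hF' q.1 q.2).tendsto_slope_zero.comp hu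

theorem HasDerivAt.indicator_param {F F' : ℝ → ℝ → ℝ} {Y : Set ℝ}
    (hF' : ∀ y ∈ Y, ∀ t, HasDerivAt (F y) (F' y t) t) (y t : ℝ) :
    HasDerivAt (fun s => Y.indicator (fun y => F y s) y) (Y.indicator (fun y => F' y t) y) t := by
  by_cases hy : y ∈ Y
  · simpa [hy] using hF' y hy t
  · simpa [hy] using hasDerivAt_const t (0 : ℝ)

theorem ConvexOn.second_deriv_nonneg {f f' : ℝ → ℝ} {f'' t : ℝ} (hf : ConvexOn ℝ univ f)
    (hf' : ∀ s, HasDerivAt f (f' s) s) (hf'' : HasDerivAt f' f'' t) : 0 ≤ f'' := by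
  have hderiv : deriv f = f' := funext fun s => (hf' s).deriv
  have hmono : Monotone f' := by
    rw [← monotoneOn_univ, ← hderiv, ← derivWithin_univ]
    exact hf.monotoneOn_derivWithin fun s _ => (hf' s).differentiableAt.differentiableWithinAt
  rw [← hf''.deriv]
  exact hmono.deriv_nonneg

section Operators

variable {H : Type*} [NormedAddCommGroup H] [InnerProductSpace ℝ H]

theorem isCompactOperator_rankOne (x y : H) :
    IsCompactOperator (InnerProductSpace.rankOne ℝ x y) :=
  (isCompactOperator_of_locallyCompactSpace_dom (innerSL ℝ y)).clm_comp
    (ContinuousLinearMap.toSpanSingleton ℝ x)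

variable [CompleteSpace H]

/-- The Bochner integral of compact operators against a probability measure is compact. -/
theorem isCompactOperator_integral {Ω : Type*} [MeasurableSpace Ω] {P : Measure Ω}
    [IsProbabilityMeasure P] {T : Ω → H →L[ℝ] H} (hT : Integrable T P)
    (hcomp : ∀ z, IsCompactOperator (T z)) : IsCompactOperator (∫ z, T z ∂P : H →L[ℝ] H) :=
  (compactOperator (RingHom.id ℝ) H H).convex.integral_mem
    isClosed_setOfPred_isCompactOperator (Eventually.of_forall hcomp) hT

/-- A positive multiple of the identity plus an operator with nonnegative quadratic form is
invertible. -/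
theorem exists_continuousLinearEquiv_smul_add (A : H →L[ℝ] H) (hA : ∀ g, 0 ≤ ⟪A g, g⟫) {c : ℝ}
    (hc : 0 < c) : ∃ S : H ≃L[ℝ] H, ∀ g, S g = c • g + A g := by
  let B : H →L[ℝ] H →L[ℝ] ℝ := (innerSL ℝ).comp (c • ContinuousLinearMap.id ℝ H + A)
  have hB : ∀ v w, B v w = ⟪c • v + A v, w⟫ := fun v w => rfl
  have hcoer : IsCoercive B := ⟨c, hc, fun v => by
    rw [hB, inner_add_left, real_inner_smul_left, real_inner_self_eq_norm_mul_norm]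
    linarith [hA v]⟩
  refine ⟨hcoer.continuousLinearEquivOfBilin, fun g => ext_inner_right ℝ fun w => ?_⟩
  rw [hcoer.continuousLinearEquivOfBilin_apply, hB]

/-- The weighted integral of the rank-one operators `g ↦ ⟪g, φ z⟫ φ z` is a compact operator, and
adding a positive multiple of the identity makes it invertible. -/
theorem exists_compact_weighted_covariance {Ω : Type*} [MeasurableSpace Ω] {P : Measure Ω}
    [IsProbabilityMeasure P] {w : Ω → ℝ} (hw : Integrable w P) (hw0 : ∀ᵐ z ∂P, 0 ≤ w z)
    {φ : Ω → H} (hφ : StronglyMeasurable φ) {κ : ℝ} (hκ : ∀ z, ‖φ z‖ ≤ κ) {c : ℝ} (hc : 0 < c) :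
    ∃ A : H →L[ℝ] H,
      (∀ g : H, A g = ∫ z, (w z * ⟪g, φ z⟫) • φ z ∂P) ∧
      IsCompactOperator (⇑A) ∧
      ∃ S : H ≃L[ℝ] H, ∀ g : H, S g = c • g + A g := by
  let T : Ω → H →L[ℝ] H := fun z => w z • InnerProductSpace.rankOne ℝ (φ z) (φ z)
  have hrank : Continuous fun x : H => InnerProductSpace.rankOne ℝ x x :=
    (InnerProductSpace.rankOne ℝ).continuous.clm_apply continuous_id
  have hT : Integrable T P := by
    refine hw.smul_bdd (κ * κ) (hrank.comp_stronglyMeasurable hφ).aestronglyMeasurable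
      (Eventually.of_forall fun z => ?_)
    rw [InnerProductSpace.norm_rankOne]
    exact mul_self_le_mul_self (norm_nonneg _) (hκ z)
  have hTapply : ∀ g z, T z g = (w z * ⟪g, φ z⟫) • φ z := fun g z => by
    simp [T, smul_smul, real_inner_comm]
  refine ⟨∫ z, T z ∂P, fun g => ?_, isCompactOperator_integral hT fun z =>
    (isCompactOperator_rankOne _ _).smul (w z),
    exists_continuousLinearEquiv_smul_add _ (fun g => ?_) hc⟩
  · simp_rw [ContinuousLinearMap.integral_apply hT, hTapply]
  · rw [ContinuousLinearMap.integral_apply hT, real_inner_comm,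
      ← integral_inner (hT.apply_continuousLinearMap g)]
    refine integral_nonneg_of_ae (hw0.mono fun z hz => ?_)
    simp only [hTapply, real_inner_smul_right, Pi.zero_apply, mul_assoc]
    exact mul_nonneg hz (mul_self_nonneg _)

end Operators

/-- From the proof of Theorem 15: the operator
`A g := E_P[L''(Y, f_{P,λ}(X)) ⟪g, Φ(X)⟫ Φ(X)]` is a compact operator on `H`, and
`S := 2λ id_H + A` is an invertible bounded linear operator on `H`. -/
theorem kbr_hessian_compact_and_invertible
    {d : ℕ} (X : Set (EuclideanSpace ℝ (Fin d))) (hXclosed : IsClosed X)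
    (Y : Set ℝ) (hYne : Y.Nonempty) (hYclosed : IsClosed Y)
    {H : Type*} [NormedAddCommGroup H] [InnerProductSpace ℝ H] [CompleteSpace H]
    [SecondCountableTopology H]
    (Φ : X → H) (hΦcont : Continuous Φ) (hΦmeas : StronglyMeasurable Φ)
    (kb : ℝ) (hkb : ∀ x : X, ‖Φ x‖ ≤ kb)
    (L L' L'' : ℝ → ℝ → ℝ)
    (hLmeas : Measurable fun q : ℝ × ℝ => L q.1 q.2)
    (hLnonneg : ∀ y ∈ Y, ∀ t : ℝ, 0 ≤ L y t)
    (hLconv : ∀ y ∈ Y, ConvexOn ℝ Set.univ (L y))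
    (hL' : ∀ y ∈ Y, ∀ t : ℝ, HasDerivAt (L y) (L' y t) t)
    (hL'' : ∀ y ∈ Y, ∀ t : ℝ, HasDerivAt (L' y) (L'' y t) t)
    (a : ℝ → ℝ) (hameas : Measurable a) (hanonneg : ∀ y ∈ Y, 0 ≤ a y)
    (p : ℝ) (hp : 0 ≤ p)
    (htypeL : ∃ c > (0 : ℝ), ∀ y ∈ Y, ∀ t : ℝ, L y t ≤ c * (a y + |t| ^ p + 1))
    (htypeL' : ∃ c > (0 : ℝ), ∀ y ∈ Y, ∀ t : ℝ, |L' y t| ≤ c * (a y + |t| ^ p + 1))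
    (htypeL'' : ∃ c > (0 : ℝ), ∀ y ∈ Y, ∀ t : ℝ, |L'' y t| ≤ c * (a y + |t| ^ p + 1))
    (lam : ℝ) (hlam : 0 < lam)
    (P : Measure (X × ℝ)) [IsProbabilityMeasure P]
    (hPsupp : ∀ᵐ z ∂P, z.2 ∈ Y)
    (hPa : Integrable (fun z : X × ℝ => a z.2) P)
    (fP : H)
    (hfP : ∀ f : H,
      (∫ z, L z.2 ⟪fP, Φ z.1⟫ ∂P) + lam * ‖fP‖ ^ 2 ≤
        (∫ z, L z.2 ⟪f, Φ z.1⟫ ∂P) + lam * ‖f‖ ^ 2) :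
    ∃ A : H →L[ℝ] H,
      (∀ g : H,
        A g = ∫ z, (L'' z.2 ⟪fP, Φ z.1⟫ * ⟪g, Φ z.1⟫) • Φ z.1 ∂P) ∧
      IsCompactOperator (⇑A) ∧
      ∃ S : H ≃L[ℝ] H, ∀ g : H, S g = (2 * lam) • g + A g := by
  obtain ⟨c, hc, hcbound⟩ := htypeL''
  have hYm : MeasurableSet Y := hYclosed.measurableSet
  have hmL : Measurable fun q : ℝ × ℝ => Y.indicator (fun y => L y q.2) q.1 :=
    hLmeas.indicator (measurable_fst hYm)
  have hmL'' : Measurable fun q : ℝ × ℝ => Y.indicator (fun y => L'' y q.2) q.1 :=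
    measurable_uncurry_of_hasDerivAt
      (F := fun y t => Y.indicator (fun y => L' y t) y)
      (F' := fun y t => Y.indicator (fun y => L'' y t) y)
      (measurable_uncurry_of_hasDerivAt
        (F := fun y t => Y.indicator (fun y => L y t) y)
        (F' := fun y t => Y.indicator (fun y => L' y t) y) hmL
        (HasDerivAt.indicator_param hL'))
      (HasDerivAt.indicator_param hL'')
  have hφ : StronglyMeasurable fun z : X × ℝ => Φ z.1 := hΦmeas.comp_measurable measurable_fst
  have hpred : Measurable fun z : X × ℝ => ⟪fP, Φ z.1⟫ :=
    ((innerSL ℝ fP).continuous.comp_stronglyMeasurable hφ).measurable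
  have hweight : AEStronglyMeasurable (fun z : X × ℝ => L'' z.2 ⟪fP, Φ z.1⟫) P :=
    (hmL''.comp (measurable_snd.prodMk hpred)).aestronglyMeasurable.congr
      (hPsupp.mono fun z hz => by simp [hz])
  have hdom : Integrable (fun z : X × ℝ => c * (a z.2 + (‖fP‖ * kb) ^ p + 1)) P :=
    ((hPa.add (integrable_const _)).add (integrable_const _)).const_mul c
  refine exists_compact_weighted_covariance
    (hdom.mono' hweight (hPsupp.mono fun z hz => (hcbound z.2 hz _).trans ?_))
    (hPsupp.mono fun z hz => (hLconv z.2 hz).second_deriv_nonneg (hL' z.2 hz) (hL'' z.2 hz _))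
    hφ (fun z => hkb z.1) (by positivity)
  have hpred_le : |⟪fP, Φ z.1⟫| ≤ ‖fP‖ * kb :=
    (abs_real_inner_le_norm _ _).trans (mul_le_mul_of_nonneg_left (hkb z.1) (norm_nonneg _))
  gcongr
end

section
/- Let L: Y × ℝ → [0,∞) be a convex, invariant, Lipschitz continuous loss function with Lipschitz constant |L|_1, let H be the RKHS of a bounded continuous kernel k on X, and let λ > 0. For a sample (z_1, …, z_n) ∈ (X × Y)^n let T_n(z_1, …, z_n) := f_{D_n,λ} ∈ H be the unique minimizer of f ↦ (1/n)∑_{i=1}^n L(y_i, f(x_i)) + λ‖f‖_H², and define the sensitivity curve SC_n(z; T_n) := n·(T_n(z_1, …, z_{n−1}, z) − T_{n−1}(z_1, …, z_{n−1})) for z ∈ X × Y. Then ‖SC_n(z; T_n)‖_H ≤ 2·λ^{−1}·‖k‖_∞·|L|_1 for all z ∈ X × Y and all samples (z_1, …, z_{n−1}). -/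
open MeasureTheory Filter Set Topology
open scoped RealInnerProductSpace BigOperators

/-- A minimizer of a convex functional penalized by `lam * ‖f‖ ^ 2` satisfies quadratic growth. -/
theorem ConvexOn.add_sq_norm_sub_le_of_isMin
    {H : Type*} [NormedAddCommGroup H] [InnerProductSpace ℝ H] {R : H → ℝ}
    (hR : ConvexOn ℝ univ R) {lam : ℝ} {T : H}
    (hT : ∀ f, R T + lam * ‖T‖ ^ 2 ≤ R f + lam * ‖f‖ ^ 2) (g : H) :
    R T + lam * ‖T‖ ^ 2 + lam * ‖g - T‖ ^ 2 ≤ R g + lam * ‖g‖ ^ 2 := by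
  have hsegment : ∀ t ∈ Ioo (0 : ℝ) 1,
      R T - R g - 2 * lam * ⟪T, g - T⟫ ≤ t * (lam * ‖g - T‖ ^ 2) := by
    rintro t ⟨ht0, ht1⟩
    have hmin := hT (T + t • (g - T))
    have hconvex := hR.2 (mem_univ T) (mem_univ g) (sub_nonneg.2 ht1.le) ht0.le
      (sub_add_cancel 1 t)
    have hpoint : (1 - t) • T + t • g = T + t • (g - T) := by module
    rw [hpoint, smul_eq_mul, smul_eq_mul] at hconvex
    rw [norm_add_sq_real, inner_smul_right, norm_smul, mul_pow, Real.norm_eq_abs, sq_abs] at hmin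
    refine le_of_mul_le_mul_left ?_ ht0
    linarith
  have hslope : R T - R g - 2 * lam * ⟪T, g - T⟫ ≤ 0 := by
    have hlim : Tendsto (fun t : ℝ => t * (lam * ‖g - T‖ ^ 2)) (𝓝[>] 0) (𝓝 0) := by
      have : Continuous fun t : ℝ => t * (lam * ‖g - T‖ ^ 2) := by fun_prop
      simpa using (this.tendsto 0).mono_left nhdsWithin_le_nhds
    exact ge_of_tendsto hlim
      (mem_of_superset (Ioo_mem_nhdsGT one_pos) hsegment)
  have hnorm : ‖g‖ ^ 2 = ‖T‖ ^ 2 + 2 * ⟪T, g - T⟫ + ‖g - T‖ ^ 2 := by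
    rw [← norm_add_sq_real, add_sub_cancel]
  rw [hnorm]
  linarith

/-- A convex function of a residual is convex in the predictor. -/
theorem ConvexOn.comp_sub_inner
    {H : Type*} [NormedAddCommGroup H] [InnerProductSpace ℝ H] {l : ℝ → ℝ}
    (hl : ConvexOn ℝ univ l) (y : ℝ) (v : H) :
    ConvexOn ℝ univ fun f : H => l (y - ⟪f, v⟫) := by
  refine ⟨convex_univ, fun f _ g _ a b ha hb hab => ?_⟩
  convert hl.2 (mem_univ (y - ⟪f, v⟫)) (mem_univ (y - ⟪g, v⟫)) ha hb hab using 2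
  simp only [inner_add_left, real_inner_smul_left, smul_eq_mul]
  linear_combination (-y) * hab

/-- A finite sum of convex real functions on the whole space is convex. -/
theorem convexOn_univ_finset_sum {E ι : Type*} [AddCommGroup E] [Module ℝ E]
    (s : Finset ι) {F : ι → E → ℝ} (hF : ∀ i ∈ s, ConvexOn ℝ univ (F i)) :
    ConvexOn ℝ univ fun x => ∑ i ∈ s, F i x := by
  refine ⟨convex_univ, fun x _ y _ a b ha hb hab => ?_⟩
  simp only [Finset.smul_sum, ← Finset.sum_add_distrib]
  exact Finset.sum_le_sum fun i hi => (hF i hi).2 (mem_univ x) (mem_univ y) ha hb hab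

/-- Theorem 17 (third part): bound on the sensitivity curve. For a convex, invariant,
Lipschitz continuous loss with Lipschitz constant `|L|₁` and the RKHS of a bounded
continuous kernel, the sensitivity curve
`SC_n(z) = n (T_n(z_1,…,z_{n-1},z) - T_{n-1}(z_1,…,z_{n-1}))` of the empirical
regularized risk minimizer satisfies `‖SC_n(z)‖_H ≤ 2 λ⁻¹ ‖k‖_∞ |L|₁` for every
point `z` and every sample `(z_1,…,z_{n-1})` (here `n = m + 1`). -/
theorem kbr_sensitivity_curve_bound
    {X : Type*} [MeasurableSpace X] [TopologicalSpace X]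
    {H : Type*} [NormedAddCommGroup H] [InnerProductSpace ℝ H] [CompleteSpace H]
    [SecondCountableTopology H]
    (Y : Set ℝ) (hYne : Y.Nonempty) (hYclosed : IsClosed Y)
    (L : ℝ → ℝ → ℝ)
    (hLmeas : Measurable fun q : ℝ × ℝ => L q.1 q.2)
    (l : ℝ → ℝ) (hl0 : l 0 = 0) (hlnonneg : ∀ r : ℝ, 0 ≤ l r)
    (hinv : ∀ y ∈ Y, ∀ t : ℝ, L y t = l (y - t))
    (hconv : ConvexOn ℝ Set.univ l)
    (LipL : ℝ) (hLipLpos : 0 < LipL)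
    (hLip : ∀ y ∈ Y, ∀ t t' : ℝ, |L y t - L y t'| ≤ LipL * |t - t'|)
    (hLipmin : ∀ c : ℝ, 0 ≤ c →
      (∀ y ∈ Y, ∀ t t' : ℝ, |L y t - L y t'| ≤ c * |t - t'|) → LipL ≤ c)
    (Φ : X → H) (hΦcont : Continuous Φ) (hΦmeas : StronglyMeasurable Φ)
    (kb : ℝ) (hkb : ∀ x : X, ‖Φ x‖ ≤ kb)
    (lam : ℝ) (hlam : 0 < lam)
    (m : ℕ) (data : Fin m → X × ℝ) (hdata : ∀ i, (data i).2 ∈ Y)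
    (z : X × ℝ) (hz : z.2 ∈ Y)
    (Tn Tm : H)
    (hTn : ∀ f : H,
      (1 / (m + 1 : ℝ)) * ((∑ i, L (data i).2 ⟪Tn, Φ (data i).1⟫) + L z.2 ⟪Tn, Φ z.1⟫) +
          lam * ‖Tn‖ ^ 2 ≤
        (1 / (m + 1 : ℝ)) * ((∑ i, L (data i).2 ⟪f, Φ (data i).1⟫) + L z.2 ⟪f, Φ z.1⟫) +
          lam * ‖f‖ ^ 2)
    (hTm : ∀ f : H,
      (1 / (m : ℝ)) * (∑ i, L (data i).2 ⟪Tm, Φ (data i).1⟫) + lam * ‖Tm‖ ^ 2 ≤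
        (1 / (m : ℝ)) * (∑ i, L (data i).2 ⟪f, Φ (data i).1⟫) + lam * ‖f‖ ^ 2) :
    ‖(m + 1 : ℝ) • (Tn - Tm)‖ ≤ 2 * lam⁻¹ * kb * LipL := by
  have hkb0 : 0 ≤ kb := (norm_nonneg _).trans (hkb z.1)
  have hpoint_convex : ∀ p : X × ℝ, p.2 ∈ Y →
      ConvexOn ℝ univ fun f : H => L p.2 ⟪f, Φ p.1⟫ := fun p hp => by
    simpa only [hinv p.2 hp] using hconv.comp_sub_inner p.2 (Φ p.1)
  have hpoint_lip : ∀ p : X × ℝ, p.2 ∈ Y → ∀ f g : H,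
      |L p.2 ⟪f, Φ p.1⟫ - L p.2 ⟪g, Φ p.1⟫| ≤ LipL * (‖f - g‖ * kb) := fun p hp f g => by
    refine (hLip p.2 hp _ _).trans (mul_le_mul_of_nonneg_left ?_ hLipLpos.le)
    rw [← inner_sub_left]
    exact (abs_real_inner_le_norm _ _).trans
      (mul_le_mul_of_nonneg_left (hkb p.1) (norm_nonneg _))
  have hsum_convex : ConvexOn ℝ univ fun f : H => ∑ i, L (data i).2 ⟪f, Φ (data i).1⟫ :=
    convexOn_univ_finset_sum _ fun i _ => hpoint_convex (data i) (hdata i)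
  have hgrowth_n := ((hsum_convex.add (hpoint_convex z hz)).smul
    (by positivity : (0 : ℝ) ≤ 1 / (m + 1 : ℝ))).add_sq_norm_sub_le_of_isMin hTn Tm
  have hgrowth_m := (hsum_convex.smul
    (by positivity : (0 : ℝ) ≤ 1 / (m : ℝ))).add_sq_norm_sub_le_of_isMin hTm Tn
  simp only [Pi.add_apply, smul_eq_mul, norm_sub_rev Tm Tn] at hgrowth_n hgrowth_m
  have hz_lip := (abs_le.1 (hpoint_lip z hz Tn Tm)).1
  have hsum_lip : (∑ i, L (data i).2 ⟪Tn, Φ (data i).1⟫) -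
      ∑ i, L (data i).2 ⟪Tm, Φ (data i).1⟫ ≤ m * (LipL * (‖Tn - Tm‖ * kb)) := by
    rw [← Finset.sum_sub_distrib]
    refine (Finset.sum_le_card_nsmul _ _ _ fun i _ =>
      (le_abs_self _).trans (hpoint_lip (data i) (hdata i) Tn Tm)).trans_eq ?_
    simp
  have hempty : (m : ℝ) = 0 → (∑ i, L (data i).2 ⟪Tn, Φ (data i).1⟫) -
      ∑ i, L (data i).2 ⟪Tm, Φ (data i).1⟫ = 0 := fun h => by
    obtain rfl : m = 0 := by exact_mod_cast h
    simp
  have hm0 : (0 : ℝ) ≤ m := m.cast_nonneg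
  generalize (∑ i, L (data i).2 ⟪Tn, Φ (data i).1⟫) = Sn at *
  generalize (∑ i, L (data i).2 ⟪Tm, Φ (data i).1⟫) = Sm at *
  generalize L z.2 ⟪Tn, Φ z.1⟫ = zn at *
  generalize L z.2 ⟪Tm, Φ z.1⟫ = zm at *
  rw [norm_smul, Real.norm_of_nonneg (by positivity)]
  have hd0 := norm_nonneg (Tn - Tm)
  generalize ‖Tn - Tm‖ = d at *
  generalize (m : ℝ) = M at *
  have hmean : 1 / M * (Sn - Sm) ≤ LipL * (d * kb) := by
    rcases hm0.eq_or_lt' with rfl | hM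
    · simp only [div_zero, zero_mul]; positivity
    · rw [one_div, inv_mul_le_iff₀ hM]; exact hsum_lip
  have hsplit : (M + 1) * (1 / (M + 1) * (Sm - Sn + (zm - zn)) + 1 / M * (Sn - Sm)) =
      zm - zn + 1 / M * (Sn - Sm) := by
    rcases hm0.eq_or_lt' with rfl | hM
    · have := hempty rfl
      simp; linarith
    · field_simp; ring
  have hcombined : 2 * lam * d ^ 2 ≤
      1 / (M + 1) * (Sm - Sn + (zm - zn)) + 1 / M * (Sn - Sm) := by linarith
  have hquad : (M + 1) * (2 * lam * d ^ 2) ≤ 2 * (LipL * (d * kb)) := by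
    have := mul_le_mul_of_nonneg_left hcombined (by positivity : 0 ≤ M + 1)
    linarith
  have hC : 0 ≤ lam⁻¹ * kb * LipL := by positivity
  rcases hd0.eq_or_lt' with rfl | hd
  · linarith
  · have hlinear : lam * ((M + 1) * d) ≤ kb * LipL :=
      le_of_mul_le_mul_left (by linarith) (by positivity : 0 < 2 * d)
    have := (le_inv_mul_iff₀ hlam).2 hlinear
    linarith
end
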